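/- arXiv:2212.01604 — 4 statements merged into one kernel-verified Lean document; each statement's English description precedes it below -/
import Mathlib

section
/- Every nonempty zero-closed semigroup X satisfies cov(A_X) < max{2, |X|}. In particular, every zero-closed infinite semigroup X has cov(A_X) < |X|. -/
open Cardinal Pointwise

universe u

namespace ZeroClosedPaper

/-- The value of the semigroup polynomial with coefficient list `a = [a₀, a₁, …, aₙ]`
(coefficients in `X¹ = WithOne X`) at the point `x`, i.e. `a₀xa₁x⋯xaₙ`,
computed in the monoid `WithOne X`. Its degree (the number of occurrences of `x`)
is `a.length - 1`. -/
def polyVal {X : Type*} [Semigroup X] (a : List (WithOne X)) (x : X) : WithOne X :=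
  match a with
  | [] => 1
  | a₀ :: rest => a₀ * (rest.map (fun ai => (x : WithOne X) * ai)).prod

/-- A subset `A` of a semigroup `X` is algebraic if
`A = {x ∈ X : a₀xa₁⋯xaₙ = b}` for some `n ≥ 1`, `b ∈ X` and `a₀,…,aₙ ∈ X¹`. -/
def IsAlgebraicSet {X : Type*} [Semigroup X] (A : Set X) : Prop :=
  ∃ (a : List (WithOne X)) (b : X), 2 ≤ a.length ∧
    A = {x : X | polyVal a x = (b : WithOne X)}

/-- The polyboundedness number `cov(A_X)`: the smallest cardinality of a cover of `X`
by algebraic subsets of `X`. -/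
noncomputable def covA (X : Type*) [Semigroup X] : Cardinal :=
  sInf {c : Cardinal | ∃ C : Set (Set X), (∀ A ∈ C, IsAlgebraicSet A) ∧
    ⋃₀ C = Set.univ ∧ Cardinal.mk ↥C = c}

/-- A subset `S` of a semigroup `X` is polybounded in `X` if it can be covered by
finitely many algebraic subsets of `X`. -/
def PolyboundedIn {X : Type*} [Semigroup X] (S : Set X) : Prop :=
  ∃ C : Set (Set X), C.Finite ∧ (∀ A ∈ C, IsAlgebraicSet A) ∧ S ⊆ ⋃₀ C

/-- A semigroup is polybounded if it admits a finite cover by algebraic sets. -/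
def Polybounded (X : Type*) [Semigroup X] : Prop :=
  PolyboundedIn (Set.univ : Set X)

/-- A semigroup `X` is polyfinite if there are `n ∈ ℕ` and a finite `F ⊆ X` such that
for all `x, y ∈ X` some semigroup polynomial `f` of degree `≤ n` has `f(x), f(y) ∈ F`. -/
def Polyfinite (X : Type*) [Semigroup X] : Prop :=
  ∃ (n : ℕ) (F : Set X), F.Finite ∧ ∀ x y : X, ∃ a : List (WithOne X),
    2 ≤ a.length ∧ a.length ≤ n + 1 ∧
    (∃ u ∈ F, polyVal a x = (u : WithOne X)) ∧
    (∃ v ∈ F, polyVal a y = (v : WithOne X))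

/-- A semigroup `X` is zero-closed if `X` is closed in its `0`-extension
`X⁰ = WithZero X` endowed with any Hausdorff semigroup topology. -/
def ZeroClosed (X : Type*) [Semigroup X] : Prop :=
  ∀ τ : TopologicalSpace (WithZero X),
    @T2Space (WithZero X) τ → @ContinuousMul (WithZero X) τ _ →
    @IsClosed (WithZero X) τ (Set.range ((↑) : X → WithZero X))

/-- `d` is a pseudometric. -/
def IsPseudometric {X : Type*} (d : X → X → ℝ) : Prop :=
  (∀ x, d x x = 0) ∧ (∀ x y, d x y = d y x) ∧ (∀ x y z, d x z ≤ d x y + d y z)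

/-- `d` is subinvariant: `d(axb, ayb) ≤ d(x,y)` for all `a, b ∈ X¹`
(equivalently, `d` is both left- and right-nonexpansive under translations). -/
def Subinvariant {X : Type*} [Semigroup X] (d : X → X → ℝ) : Prop :=
  (∀ a x y : X, d (a * x) (a * y) ≤ d x y) ∧
  (∀ b x y : X, d (x * b) (y * b) ≤ d x y)

/-- `d` is separable: some countable set is `d`-dense. -/
def SeparablePseudometric {X : Type*} (d : X → X → ℝ) : Prop :=
  ∃ C : Set X, C.Countable ∧ ∀ x : X, ∀ ε : ℝ, 0 < ε → ∃ c ∈ C, d x c < ε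

/-- `cov(M)`: the smallest cardinality of a cover of the real line by meager sets. -/
noncomputable def covMeager : Cardinal :=
  sInf {c : Cardinal | ∃ S : Set (Set ℝ), (∀ A ∈ S, IsMeagre A) ∧
    ⋃₀ S = Set.univ ∧ Cardinal.mk ↥S = c}

/-- `cov(N̄)`: the smallest cardinality of a cover of the real line by closed
Lebesgue-null sets. -/
noncomputable def covClosedNull : Cardinal :=
  sInf {c : Cardinal | ∃ S : Set (Set ℝ),
    (∀ A ∈ S, IsClosed A ∧ MeasureTheory.volume A = 0) ∧
    ⋃₀ S = Set.univ ∧ Cardinal.mk ↥S = c}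

/-- A topological space is power-Lindelöf if each finite power is Lindelöf. -/
def PowerLindelof (Y : Type*) [TopologicalSpace Y] : Prop :=
  ∀ n : ℕ, LindelofSpace (Fin n → Y)

/-- `I` is an ideal of the semigroup `X`. -/
def IsIdeal {X : Type*} [Semigroup X] (I : Set X) : Prop :=
  ∀ x ∈ I, ∀ a : X, x * a ∈ I ∧ a * x ∈ I

/-- The value at `x` of a word over `X` and one variable, where `none` stands for the variable. -/
def wordVal {X : Type*} [Semigroup X] (x : X) (w : List (Option X)) : WithOne X :=
  (w.map fun o => ((o.getD x : X) : WithOne X)).prod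

section Words

variable {X : Type*} [Semigroup X]

theorem wordVal_append (x : X) (v w : List (Option X)) :
    wordVal x (v ++ w) = wordVal x v * wordVal x w := by
  simp [wordVal]

theorem wordVal_map_getD (x y : X) (w : List (Option X)) :
    wordVal y (w.map fun o => some (o.getD x)) = wordVal x w := by
  simp [wordVal, Function.comp_def]

theorem polyVal_one_cons (x : X) (b : WithOne X) (l : List (WithOne X)) :
    polyVal (1 :: b :: l) x = x * polyVal (b :: l) x := by
  simp [polyVal, mul_assoc]

theorem polyVal_mul_cons (x : X) (c b : WithOne X) (l : List (WithOne X)) :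
    polyVal ((c * b) :: l) x = c * polyVal (b :: l) x := by
  simp [polyVal, mul_assoc]

theorem exists_polyVal_eq_wordVal (w : List (Option X)) :
    ∃ (b : WithOne X) (l : List (WithOne X)), (none ∈ w → l ≠ []) ∧
      ∀ x : X, polyVal (b :: l) x = wordVal x w := by
  induction w with
  | nil => exact ⟨1, [], by simp, fun x => by simp [polyVal, wordVal]⟩
  | cons o w ih =>
    obtain ⟨b, l, hl, h⟩ := ih
    cases o with
    | none =>
      refine ⟨1, b :: l, by simp, fun x => ?_⟩
      rw [polyVal_one_cons, h]
      simp [wordVal]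
    | some c =>
      refine ⟨c * b, l, fun hn => hl (by simpa using hn), fun x => ?_⟩
      rw [polyVal_mul_cons, h]
      simp [wordVal]

theorem isAlgebraicSet_wordVal {w : List (Option X)} (hw : none ∈ w) (b : X) :
    IsAlgebraicSet {x : X | wordVal x w = b} := by
  obtain ⟨c, l, hl, h⟩ := exists_polyVal_eq_wordVal w
  refine ⟨c :: l, b, ?_, by simp [h]⟩
  have := List.length_pos_iff.2 (hl hw)
  simp only [List.length_cons]
  omega

theorem covA_le {C : Set (Set X)} (hC : ∀ A ∈ C, IsAlgebraicSet A) (h : ⋃₀ C = Set.univ) :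
    covA X ≤ #C :=
  csInf_le' ⟨C, hC, h, rfl⟩

/-- A finite semigroup has an idempotent `e` that is minimal in the natural partial order. -/
theorem exists_minimal_idempotent [Finite X] [Nonempty X] :
    ∃ e : X, e * e = e ∧ ∀ f : X, f * f = f → e * f = f → f * e = f → f = e := by
  let : TopologicalSpace X := ⊥
  have : DiscreteTopology X := ⟨rfl⟩
  obtain ⟨e₀, he₀⟩ := exists_idempotent_of_compact_t2_of_continuous_mul_left
    (M := X) fun _ => continuous_of_discreteTopology
  obtain ⟨e, he, hmin⟩ := Set.exists_min_image {e : X | e * e = e}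
    (fun e => {x : X | e * x = x ∧ x * e = x}.ncard) (Set.toFinite _) ⟨e₀, he₀⟩
  refine ⟨e, he, fun f hf hef hfe => ?_⟩
  by_contra hne
  refine (hmin f hf).not_gt (Set.ncard_lt_ncard ?_ (Set.toFinite _))
  refine (Set.ssubset_iff_of_subset ?_).2 ⟨e, ⟨he, he⟩, fun h => hne (hfe.symm.trans h.1)⟩
  rintro x ⟨h₁, h₂⟩
  constructor
  · rw [← h₁, ← mul_assoc, hef]
  · rw [← h₂, mul_assoc, hfe]

/-- On a finite semigroup, some semigroup polynomial of positive degree is constant. -/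
theorem exists_wordVal_const [Finite X] [Nonempty X] :
    ∃ (w : List (Option X)) (e : X), none ∈ w ∧ ∀ x : X, wordVal x w = e := by
  obtain ⟨e, he, hmin⟩ := exists_minimal_idempotent (X := X)
  let : TopologicalSpace (X → X) := ⊥
  have : DiscreteTopology (X → X) := ⟨rfl⟩
  obtain ⟨h, ⟨⟨w, hw, hwh⟩, hl, hr⟩, hh⟩ := exists_idempotent_in_compact_subsemigroup
    (M := X → X) (fun _ => continuous_of_discreteTopology)
    {h | (∃ w : List (Option X), none ∈ w ∧ ∀ x, wordVal x w = h x) ∧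
      (∀ x, e * h x = h x) ∧ ∀ x, h x * e = h x}
    ⟨fun x => e * (x * e), ⟨[some e, none, some e], by simp, fun x => by simp [wordVal]⟩,
      fun x => by rw [← mul_assoc, he], fun x => by simp only [mul_assoc, he]⟩
    (Set.toFinite _).isCompact
    (by
      rintro f ⟨⟨v, hv, hvf⟩, hfl, hfr⟩ g ⟨⟨w, hw, hwg⟩, hgl, hgr⟩
      refine ⟨⟨v ++ w, by simp [hv], fun x => ?_⟩, fun x => ?_, fun x => ?_⟩
      · simp [wordVal_append, hvf, hwg]
      · simp only [Pi.mul_apply]; rw [← mul_assoc, hfl]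
      · simp only [Pi.mul_apply]; rw [mul_assoc, hgr])
  refine ⟨w, e, hw, fun x => ?_⟩
  rw [hwh, hmin (h x) (congrFun hh x) (hl x) (hr x)]

theorem covA_le_one_of_finite [Finite X] [Nonempty X] : covA X ≤ 1 := by
  obtain ⟨w, e, hw, h⟩ := exists_wordVal_const (X := X)
  refine (covA_le (C := {{x : X | wordVal x w = e}}) ?_ ?_).trans (by simp)
  · rintro A rfl
    exact isAlgebraicSet_wordVal hw e
  · simp [h]

end Words

section Topology

open Filter Topology

variable {X : Type*} [Semigroup X]

/-- The trace on `X` of the neighborhood filter of `0` determines a Hausdorff semigroup topology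
on `X⁰` in which the points of `X` are isolated. -/
theorem not_zeroClosed_of_filter (F : Filter X) [F.NeBot] (h₀ : ∀ x, {x}ᶜ ∈ F)
    (hl : ∀ x, Tendsto (fun y => x * y) F F) (hr : ∀ x, Tendsto (fun y => y * x) F F)
    (hm : Tendsto (fun p : X × X => p.1 * p.2) (F ×ˢ F) F) : ¬ ZeroClosed X := by
  intro hz
  let G : Filter (WithZero X) := map (↑) F
  let τ : TopologicalSpace (WithZero X) := nhdsAdjoint 0 G
  have n0 : 𝓝 (0 : WithZero X) = pure 0 ⊔ G := nhds_nhdsAdjoint_same _ _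
  have nx (x : X) : 𝓝 (x : WithZero X) = pure (x : WithZero X) :=
    nhds_nhdsAdjoint_of_ne _ WithZero.coe_ne_zero
  have hdisj (x : X) : Disjoint (𝓝 (0 : WithZero X)) (𝓝 (x : WithZero X)) := by
    rw [n0, nx, disjoint_sup_left]
    constructor
    · exact disjoint_pure_pure.2 WithZero.coe_ne_zero.symm
    · rw [← principal_singleton, disjoint_principal_right, mem_map]
      filter_upwards [h₀ x] with y hy
      simpa using hy
  have hT : T2Space (WithZero X) := by
    rw [t2Space_iff_disjoint_nhds]
    intro a b hab
    induction a with
    | zero =>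
      induction b with
      | zero => exact absurd rfl hab
      | coe b => exact hdisj b
    | coe a =>
      induction b with
      | zero => exact (hdisj a).symm
      | coe b => rw [nx, nx]; simpa using hab
  have hG : G ≤ 𝓝 (0 : WithZero X) := by rw [n0]; exact le_sup_right
  have hcoe : Tendsto ((↑) : X → WithZero X) F (𝓝 0) := hG
  have hM : ContinuousMul (WithZero X) := by
    refine ⟨continuous_iff_continuousAt.2 ?_⟩
    rintro ⟨a, b⟩
    rw [ContinuousAt, nhds_prod_eq]
    induction a with
    | zero =>
      induction b with
      | zero =>
        simp only [mul_zero]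
        rw [n0, sup_prod, prod_sup, prod_sup, ← n0]
        refine (Tendsto.sup ?_ ?_).sup (Tendsto.sup ?_ ?_)
        · simpa [tendsto_pure_left] using fun s hs => mem_of_mem_nhds hs
        · rw [pure_prod, tendsto_map'_iff]
          simp [Function.comp_def]
        · rw [prod_pure, tendsto_map'_iff]
          simp [Function.comp_def]
        · rw [prod_map_map_eq, tendsto_map'_iff]
          simpa [Function.comp_def] using hcoe.comp hm
      | coe b =>
        simp only [zero_mul]
        rw [nx, prod_pure, tendsto_map'_iff]
        nth_rewrite 1 [n0]
        refine Tendsto.sup ?_ ?_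
        · rw [tendsto_pure_left, Function.comp_apply, zero_mul]
          exact fun s hs => mem_of_mem_nhds hs
        · rw [tendsto_map'_iff]
          simpa [Function.comp_def] using hcoe.comp (hr b)
    | coe a =>
      induction b with
      | zero =>
        simp only [mul_zero]
        rw [nx, pure_prod, tendsto_map'_iff]
        nth_rewrite 1 [n0]
        refine Tendsto.sup ?_ ?_
        · rw [tendsto_pure_left, Function.comp_apply, mul_zero]
          exact fun s hs => mem_of_mem_nhds hs
        · rw [tendsto_map'_iff]
          simpa [Function.comp_def] using hcoe.comp (hl a)
      | coe b =>
        rw [nx, nx, pure_prod, Filter.map_pure, tendsto_pure_left]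
        exact fun s hs => mem_of_mem_nhds hs
  have hcl := hz τ hT hM
  obtain ⟨x, hx⟩ := hcl.mem_of_tendsto hcoe (Eventually.of_forall Set.mem_range_self)
  exact WithZero.coe_ne_zero hx

end Topology

section Construction

open Filter

variable {X : Type u} {I : Type*}

/-- The words over one variable whose coefficients belong to `T`. -/
def WordsOver (T : Set X) : Set (List (Option X)) :=
  {w | ∀ c, some c ∈ w → c ∈ T}

theorem wordsOver_subset_range (T : Set X) :
    WordsOver T ⊆ Set.range (List.map (Option.map ((↑) : T → X))) := by
  intro w hw
  rw [Set.range_list_map]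
  rintro (_ | c) ho
  · exact ⟨none, rfl⟩
  · exact ⟨some ⟨c, hw c ho⟩, rfl⟩

/-- A transfinite recursion in which each value depends on the set of previous values. -/
theorem exists_recursive_seq [LinearOrder I] [WellFoundedLT I] (pick : I → Set X → X) :
    ∃ z : I → X, ∀ β, z β = pick β (z '' Set.Iio β) := by
  let step : ∀ β : I, (∀ γ, γ < β → X) → X := fun β ih => pick β {y | ∃ γ, ∃ h : γ < β, ih γ h = y}
  refine ⟨(wellFounded_lt (α := I)).fix step, fun β => ?_⟩
  rw [WellFounded.fix_eq]
  refine congrArg (pick β) ?_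
  ext y
  simp

variable [Semigroup X]

/-- If fewer than `|X|` algebraic sets do not cover `X`, then a point can be chosen outside
all the algebraic sets given by few words and few values. -/
theorem exists_forall_wordVal_ne [Infinite X] (hcov : #X ≤ covA X) {W : Set (List (Option X))}
    (hW : #W < #X) {B : Set X} (hB : #B < #X) :
    ∃ x : X, ∀ w ∈ W, none ∈ w → ∀ b ∈ B, wordVal x w ≠ b := by
  by_contra! hcon
  let W' : Set (List (Option X)) := {w ∈ W | none ∈ w}
  let C : Set (Set X) := (fun p : List (Option X) × X => {x : X | wordVal x p.1 = p.2}) '' (W' ×ˢ B)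
  have hC : #C < #X := by
    refine mk_image_le.trans_lt ?_
    rw [mk_setProd]
    exact mul_lt_of_lt (aleph0_le_mk X) ((mk_le_mk_of_subset (Set.sep_subset _ _)).trans_lt hW) hB
  refine (hcov.trans (covA_le (C := C) ?_ ?_)).not_gt hC
  · rintro _ ⟨⟨w, b⟩, ⟨hw, -⟩, rfl⟩
    exact isAlgebraicSet_wordVal hw.2 b
  · refine Set.eq_univ_of_forall fun x => ?_
    obtain ⟨w, hw, hn, b, hb, h⟩ := hcon x
    exact ⟨_, ⟨(w, b), ⟨⟨hw, hn⟩, hb⟩, rfl⟩, h⟩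

/-- The construction of a filter converging to zero. Here `e` enumerates `X`, and `A α β` is the
set of lengths of the words in the `β`-th generator which are admissible in the `α`-th neighborhood
of zero. -/
theorem not_zeroClosed_of_enumeration [Infinite X] (hcov : #X ≤ covA X)
    [LinearOrder I] [WellFoundedLT I] [Nonempty I]
    (e : I → X) (he : Function.Surjective e)
    (hI : ∀ (g : I → X) (β : I), #(g '' Set.Iic β) < #X)
    (A : I → I → Set ℕ)
    (hone : ∀ α β, α ≤ β → 1 ∈ A α β)
    (hanti : ∀ α α' β, α ≤ α' → A α' β ⊆ A α β)
    (hadd : ∀ α, ∃ α', α ≤ α' ∧ ∀ β γ, α' ≤ β → β ≤ γ → ∀ l ∈ A α' β, ∀ m ∈ A α' γ,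
      l + m ∈ A α γ)
    (hcard : ∀ (β : I) (T : Set X), #T < #X →
      #{w : List (Option X) | w ∈ WordsOver T ∧ ∃ α ≤ β, w.length ∈ A α β} < #X) :
    ¬ ZeroClosed X := by
  have hpick (β : I) (S : Set X) : ∃ x : X, #S < #X → ∀ w ∈ WordsOver (e '' Set.Iic β ∪ S),
      (∃ α ≤ β, w.length ∈ A α β) → none ∈ w → ∀ b ∈ e '' Set.Iic β, wordVal x w ≠ b := by
    by_cases hS : #S < #X
    · obtain ⟨x, hx⟩ := exists_forall_wordVal_ne hcov (hcard β (e '' Set.Iic β ∪ S)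
        ((mk_union_le _ _).trans_lt (add_lt_of_lt (aleph0_le_mk X) (hI e β) hS))) (hI e β)
      exact ⟨x, fun _ w hw hl => hx w ⟨hw, hl⟩⟩
    · exact ⟨Classical.arbitrary X, fun h => absurd h hS⟩
  choose pick hpick using hpick
  obtain ⟨z, hz⟩ := exists_recursive_seq pick
  let T : I → Set X := fun β => e '' Set.Iic β ∪ z '' Set.Iio β
  have hTmono {β γ : I} (h : β ≤ γ) : T β ⊆ T γ :=
    Set.union_subset_union (Set.image_mono (Set.Iic_subset_Iic.2 h))
      (Set.image_mono (Set.Iio_subset_Iio h))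
  have hzne (α β : I) (hαβ : α ≤ β) (w) (hw : w ∈ WordsOver (T β)) (hl : w.length ∈ A α β)
      (hn : none ∈ w) (j : I) (hj : j ≤ β) : wordVal (z β) w ≠ e j := by
    rw [hz β]
    exact hpick β _ ((mk_le_mk_of_subset (Set.image_mono Set.Iio_subset_Iic_self)).trans_lt (hI z β))
      w hw ⟨α, hαβ, hl⟩ hn _ ⟨j, hj, rfl⟩
  let U : I → Set X := fun α => {y | ∃ β, α ≤ β ∧ ∃ w ∈ WordsOver (T β), none ∈ w ∧
    w.length ∈ A α β ∧ wordVal (z β) w = y}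
  have hUanti {α α' : I} (h : α ≤ α') : U α' ⊆ U α := by
    rintro y ⟨β, hβ, w, hw, hn, hl, hy⟩
    exact ⟨β, h.trans hβ, w, hw, hn, hanti _ _ _ h hl, hy⟩
  have hlift {β γ : I} (h : β ≤ γ) {w} (hw : w ∈ WordsOver (T β)) :
      ∃ w' ∈ WordsOver (T γ), w'.length = w.length ∧ wordVal (z γ) w' = wordVal (z β) w := by
    rcases h.eq_or_lt with rfl | hlt
    · exact ⟨w, hw, rfl, rfl⟩
    · refine ⟨w.map fun o => some (o.getD (z β)), ?_, by simp, wordVal_map_getD _ _ _⟩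
      intro c hc
      obtain ⟨o, ho, hoc⟩ := List.mem_map.1 hc
      cases o with
      | none =>
        rw [Option.some_inj] at hoc
        exact Or.inr ⟨β, hlt, hoc⟩
      | some d =>
        rw [Option.some_inj] at hoc
        exact hTmono h (hw c (by rwa [← hoc]))
  have happ {β : I} {v w} (hv : v ∈ WordsOver (T β)) (hw : w ∈ WordsOver (T β)) :
      v ++ w ∈ WordsOver (T β) := fun c hc => (List.mem_append.1 hc).elim (hv c) (hw c)
  have hUmul (α : I) : ∃ α', α ≤ α' ∧ ∀ x ∈ U α', ∀ y ∈ U α', x * y ∈ U α := by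
    obtain ⟨α', hα, h⟩ := hadd α
    refine ⟨α', hα, ?_⟩
    rintro x ⟨β, hβ, v, hv, hvn, hvl, hx⟩ y ⟨γ, hγ, w, hw, hwn, hwl, hy⟩
    rcases le_total β γ with hle | hle
    · obtain ⟨v', hv', hlen, hval⟩ := hlift hle hv
      refine ⟨γ, hα.trans hγ, v' ++ w, happ hv' hw, by simp [hwn], ?_, ?_⟩
      · rw [List.length_append, hlen]
        exact h β γ hβ hle _ hvl _ hwl
      · rw [wordVal_append, hval, hx, hy, WithOne.coe_mul]
    · obtain ⟨w', hw', hlen, hval⟩ := hlift hle hw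
      refine ⟨β, hα.trans hβ, v ++ w', happ hv hw', by simp [hvn], ?_, ?_⟩
      · rw [List.length_append, hlen, add_comm]
        exact h γ β hγ hle _ hwl _ hvl
      · rw [wordVal_append, hval, hx, hy, WithOne.coe_mul]
  have hUtrans (x : X) (α : I) : ∃ α', ∀ y ∈ U α', x * y ∈ U α ∧ y * x ∈ U α := by
    obtain ⟨α', hα, h⟩ := hadd α
    obtain ⟨i, rfl⟩ := he x
    refine ⟨max α' i, ?_⟩
    rintro y ⟨β, hβ, w, hw, hwn, hwl, hy⟩
    have hβ' := (le_max_left α' i).trans hβ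
    have hx : [some (e i)] ∈ WordsOver (T β) := by
      intro c hc
      simp only [List.mem_singleton, Option.some_inj] at hc
      exact Or.inl ⟨i, (le_max_right α' i).trans hβ, hc.symm⟩
    have hlen := h β β hβ' le_rfl 1 (hone _ _ hβ') _ (hanti _ _ _ (le_max_left α' i) hwl)
    have hxv : wordVal (z β) [some (e i)] = e i := by simp [wordVal]
    refine ⟨⟨β, hα.trans hβ', [some (e i)] ++ w, happ hx hw, by simp [hwn], ?_, ?_⟩,
      ⟨β, hα.trans hβ', w ++ [some (e i)], happ hw hx, by simp [hwn], ?_, ?_⟩⟩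
    · simpa [add_comm] using hlen
    · rw [wordVal_append, hxv, hy, WithOne.coe_mul]
    · simpa [add_comm] using hlen
    · rw [wordVal_append, hxv, hy, WithOne.coe_mul]
  have hB : (⨅ α, 𝓟 (U α)).HasBasis (fun _ => True) U :=
    hasBasis_iInf_principal fun α β =>
      ⟨max α β, hUanti (le_max_left _ _), hUanti (le_max_right _ _)⟩
  have hne : (⨅ α, 𝓟 (U α)).NeBot := hB.neBot_iff.2 fun {α} _ =>
    ⟨z α, α, le_rfl, [none], by simp [WordsOver], by simp, hone _ _ le_rfl, by simp [wordVal]⟩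
  refine not_zeroClosed_of_filter (⨅ α, 𝓟 (U α)) (fun x => ?_) (fun x => ?_) (fun x => ?_) ?_
  · obtain ⟨i, rfl⟩ := he x
    refine hB.mem_iff.2 ⟨i, trivial, ?_⟩
    rintro y ⟨β, hβ, w, hw, hwn, hwl, hy⟩ (rfl : y = e i)
    exact hzne i β hβ w hw hwl hwn i hβ hy
  · refine (hB.tendsto_iff hB).2 fun α _ => ?_
    obtain ⟨α', h⟩ := hUtrans x α
    exact ⟨α', trivial, fun y hy => (h y hy).1⟩
  · refine (hB.tendsto_iff hB).2 fun α _ => ?_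
    obtain ⟨α', h⟩ := hUtrans x α
    exact ⟨α', trivial, fun y hy => (h y hy).2⟩
  · refine ((hB.prod hB).tendsto_iff hB).2 fun α _ => ?_
    obtain ⟨α', -, h⟩ := hUmul α
    exact ⟨(α', α'), ⟨trivial, trivial⟩, fun p hp => h _ hp.1 _ hp.2⟩

theorem not_zeroClosed_of_countable [Infinite X] [Countable X] (hcov : #X ≤ covA X) :
    ¬ ZeroClosed X := by
  obtain ⟨_⟩ := nonempty_denumerable X
  have hX : #X = ℵ₀ := mk_eq_aleph0 X
  refine not_zeroClosed_of_enumeration hcov (Denumerable.eqv X).symm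
    (Denumerable.eqv X).symm.surjective ?_ (fun α β => {l | l ≤ 2 ^ (β - α)}) ?_ ?_ ?_ ?_
  · intro g β
    rw [hX, lt_aleph0_iff_set_finite]
    exact (Set.finite_Iic β).image g
  · exact fun α β _ => Nat.one_le_two_pow
  · exact fun α α' β h l hl => hl.trans (Nat.pow_le_pow_right two_pos (by omega))
  · refine fun α => ⟨α + 1, by omega, fun β γ hβ hγ l hl m hm => ?_⟩
    have h₁ : 2 ^ (β - (α + 1)) ≤ 2 ^ (γ - (α + 1)) := Nat.pow_le_pow_right two_pos (by omega)
    have h₂ : 2 ^ (γ - α) = 2 * 2 ^ (γ - (α + 1)) := by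
      rw [← pow_succ']
      congr 1
      omega
    simp only [Set.mem_ofPred_eq] at hl hm ⊢
    omega
  · intro β T hT
    rw [hX, lt_aleph0_iff_set_finite] at hT ⊢
    have := hT.to_subtype
    refine ((List.finite_length_le (Option T) (2 ^ β)).image
      (List.map (Option.map ((↑) : T → X)))).subset ?_
    rintro w ⟨hw, α, -, hl⟩
    obtain ⟨v, rfl⟩ := wordsOver_subset_range T hw
    refine ⟨v, ?_, rfl⟩
    rw [Set.mem_ofPred_eq, List.length_map] at hl
    exact hl.trans (Nat.pow_le_pow_right two_pos (Nat.sub_le _ _))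

theorem not_zeroClosed_of_uncountable [Uncountable X] (hcov : #X ≤ covA X) :
    ¬ ZeroClosed X := by
  have hX : ℵ₀ < #X := aleph0_lt_mk
  obtain ⟨e⟩ : Nonempty ((#X).ord.ToType ≃ X) := Cardinal.eq.1 (mk_ord_toType _)
  have : Nonempty (#X).ord.ToType := e.nonempty_congr.2 inferInstance
  refine not_zeroClosed_of_enumeration hcov e e.surjective ?_ (fun _ _ => Set.univ)
    (fun _ _ _ => trivial) (fun _ _ _ _ => subset_rfl)
    (fun α => ⟨α, le_rfl, fun _ _ _ _ _ _ _ _ => trivial⟩) ?_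
  · intro g β
    refine mk_image_le.trans_lt ?_
    rw [← Set.Iio_insert]
    exact mk_insert_le.trans_lt
      (add_lt_of_lt hX.le (mk_Iio_toType_ord_lt β) (one_lt_aleph0.trans hX))
  · intro β T hT
    refine (mk_le_mk_of_subset ((Set.sep_subset _ _).trans (wordsOver_subset_range T))).trans_lt ?_
    refine mk_range_le.trans_lt ((mk_list_le_max _).trans_lt (max_lt hX ?_))
    rw [mk_option]
    exact add_lt_of_lt hX.le hT (one_lt_aleph0.trans hX)

theorem covA_lt_of_infinite [Infinite X] (hz : ZeroClosed X) : covA X < #X := by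
  by_contra! hcov
  by_cases h : Countable X
  · exact not_zeroClosed_of_countable hcov hz
  · rw [not_countable_iff] at h
    exact not_zeroClosed_of_uncountable hcov hz

end Construction

/-- Every nonempty zero-closed semigroup `X` satisfies
`cov(A_X) < max {2, |X|}`; in particular every zero-closed infinite semigroup `X`
has `cov(A_X) < |X|`. -/
theorem statement0 {X : Type u} [Semigroup X] [Nonempty X] (hz : ZeroClosed X) :
    covA X < max 2 (Cardinal.mk X) ∧ (Infinite X → covA X < Cardinal.mk X) := by
  refine ⟨?_, fun _ => covA_lt_of_infinite hz⟩
  cases finite_or_infinite X with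
  | inl _ => exact covA_le_one_of_finite.trans_lt (Cardinal.one_lt_two.trans_le (le_max_left _ _))
  | inr _ => exact (covA_lt_of_infinite hz).trans_le (le_max_right _ _)

end ZeroClosedPaper
end

section
/- Every nonempty zero-closed semigroup X has a minimal ideal; equivalently, the intersection ⋂_{a∈X} XaX is nonempty (and then it is the smallest nonempty ideal of X). -/
open Cardinal Pointwise

universe u

namespace ZeroClosedPaper

/-- The topology on `X⁰` in which the points of `X` are isolated and the sets
`{0} ∪ XaX` form a neighborhood base at `0`. -/
@[reducible] def principalIdealTopology (X : Type*) [Semigroup X] [Nonempty X] :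
    TopologicalSpace (WithZero X) where
  IsOpen U := 0 ∈ U → ∃ a : X, ∀ u v : X, ((u * a * v : X) : WithZero X) ∈ U
  isOpen_univ _ := ⟨Classical.arbitrary X, fun _ _ => trivial⟩
  isOpen_inter := by
    rintro U V hU hV ⟨h0U, h0V⟩
    obtain ⟨a, ha⟩ := hU h0U
    obtain ⟨b, hb⟩ := hV h0V
    refine ⟨a * b, fun u v => ⟨?_, ?_⟩⟩
    · simpa only [mul_assoc] using ha u (b * v)
    · simpa only [mul_assoc] using hb (u * a) v
  isOpen_sUnion := by
    rintro S hS ⟨U, hU, h0⟩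
    obtain ⟨a, ha⟩ := hS U hU h0
    exact ⟨a, fun u v => ⟨U, hU, ha u v⟩⟩

lemma isOpen_principalIdealTopology_iff {X : Type*} [Semigroup X] [Nonempty X]
    {U : Set (WithZero X)} :
    @IsOpen _ (principalIdealTopology X) U ↔
      (0 ∈ U → ∃ a : X, ∀ u v : X, ((u * a * v : X) : WithZero X) ∈ U) :=
  Iff.rfl

lemma t2Space_principalIdealTopology {X : Type*} [Semigroup X] [Nonempty X]
    (h : ∀ x : X, ∃ a : X, ∀ u v : X, u * a * v ≠ x) :
    @T2Space (WithZero X) (principalIdealTopology X) := by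
  let _ := principalIdealTopology X
  have isOpen_of_zero_notMem {U : Set (WithZero X)} (hU : 0 ∉ U) : IsOpen U :=
    isOpen_principalIdealTopology_iff.2 fun h0 => absurd h0 hU
  have isOpen_compl (x : X) : IsOpen ({(x : WithZero X)}ᶜ : Set (WithZero X)) := by
    refine isOpen_principalIdealTopology_iff.2 fun _ => ?_
    obtain ⟨a, ha⟩ := h x
    exact ⟨a, fun u v huv => ha u v (WithZero.coe_injective huv)⟩
  have isOpen_singleton (x : X) : IsOpen ({(x : WithZero X)} : Set (WithZero X)) :=
    isOpen_of_zero_notMem fun h0 => WithZero.coe_ne_zero (Eq.symm h0)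
  refine ⟨fun x y hxy => ?_⟩
  induction x using WithZero.recZeroCoe with
  | coe x =>
    exact ⟨_, _, isOpen_singleton x, isOpen_compl x, rfl, hxy.symm, disjoint_compl_right⟩
  | zero =>
    induction y using WithZero.recZeroCoe with
    | zero => exact absurd rfl hxy
    | coe y => exact ⟨_, _, isOpen_compl y, isOpen_singleton y, hxy, rfl, disjoint_compl_left⟩

lemma continuousMul_principalIdealTopology (X : Type*) [Semigroup X] [Nonempty X] :
    @ContinuousMul (WithZero X) (principalIdealTopology X) _ := by
  let _ := principalIdealTopology X
  refine ⟨continuous_def.2 fun U hU => isOpen_prod_iff.2 fun p q hpq => ?_⟩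
  change p * q ∈ U at hpq
  by_cases h0 : (0 : WithZero X) ∈ U
  · obtain ⟨a, ha⟩ := isOpen_principalIdealTopology_iff.1 hU h0
    let B : Set (WithZero X) := {z | z = 0 ∨ ∃ u v : X, ((u * a * v : X) : WithZero X) = z}
    have hBU : B ⊆ U := by
      rintro z (rfl | ⟨u, v, rfl⟩)
      exacts [h0, ha u v]
    have isOpen_insert (r : WithZero X) : IsOpen (insert r B) :=
      isOpen_principalIdealTopology_iff.2 fun _ => ⟨a, fun u v => Or.inr (Or.inr ⟨u, v, rfl⟩)⟩
    have mul_mem_left (r : WithZero X) {z} (hz : z ∈ B) : r * z ∈ B := by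
      obtain rfl | ⟨u, v, rfl⟩ := hz
      · exact Or.inl (mul_zero r)
      induction r using WithZero.recZeroCoe with
      | zero => exact Or.inl (zero_mul _)
      | coe r => exact Or.inr ⟨r * u, v, by simp only [← WithZero.coe_mul, mul_assoc]⟩
    have mul_mem_right (r : WithZero X) {z} (hz : z ∈ B) : z * r ∈ B := by
      obtain rfl | ⟨u, v, rfl⟩ := hz
      · exact Or.inl (zero_mul r)
      induction r using WithZero.recZeroCoe with
      | zero => exact Or.inl (mul_zero _)
      | coe r => exact Or.inr ⟨u, v * r, by simp only [← WithZero.coe_mul, mul_assoc]⟩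
    refine ⟨insert p B, insert q B, isOpen_insert p, isOpen_insert q, Or.inl rfl, Or.inl rfl, ?_⟩
    rintro ⟨y, z⟩ ⟨rfl | hy, rfl | hz⟩
    exacts [hpq, hBU (mul_mem_left _ hz), hBU (mul_mem_right _ hy), hBU (mul_mem_left _ hz)]
  · refine ⟨{p}, {q}, ?_, ?_, rfl, rfl, ?_⟩
    · refine isOpen_principalIdealTopology_iff.2 fun hp => absurd ?_ h0
      obtain rfl : 0 = p := hp
      simpa using hpq
    · refine isOpen_principalIdealTopology_iff.2 fun hq => absurd ?_ h0
      obtain rfl : 0 = q := hq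
      simpa using hpq
    · rintro ⟨y, z⟩ ⟨rfl, rfl⟩
      exact hpq

lemma ZeroClosed.exists_forall_mem_principalIdeal {X : Type*} [Semigroup X] [Nonempty X]
    (hz : ZeroClosed X) : ∃ x : X, ∀ a : X, ∃ u v : X, u * a * v = x := by
  by_contra! h
  have hclosed := hz (principalIdealTopology X) (t2Space_principalIdealTopology h)
    (continuousMul_principalIdealTopology X)
  have hopen := (@isOpen_compl_iff _ _ (principalIdealTopology X)).2 hclosed
  obtain ⟨a, ha⟩ := isOpen_principalIdealTopology_iff.1 hopen
    fun ⟨_, hx⟩ => WithZero.coe_ne_zero hx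
  exact ha a a ⟨_, rfl⟩

/-- Every nonempty zero-closed semigroup has a minimal ideal;
equivalently, `⋂_{a ∈ X} XaX` is nonempty (and then it is the smallest nonempty
ideal of `X`). -/
theorem statement1 {X : Type u} [Semigroup X] [Nonempty X] (hz : ZeroClosed X) :
    (⋂ a : X, {z : X | ∃ u v : X, u * a * v = z}).Nonempty ∧
    ∃ I : Set X, I.Nonempty ∧ IsIdeal I ∧
      (∀ J : Set X, J.Nonempty → IsIdeal J → I ⊆ J) ∧
      I = ⋂ a : X, {z : X | ∃ u v : X, u * a * v = z} := by
  obtain ⟨x, hx⟩ := hz.exists_forall_mem_principalIdeal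
  have hne : (⋂ a : X, {z : X | ∃ u v : X, u * a * v = z}).Nonempty :=
    ⟨x, Set.mem_iInter.2 hx⟩
  refine ⟨hne, _, hne, fun y hy b => ⟨?_, ?_⟩, ?_, rfl⟩
  · refine Set.mem_iInter.2 fun a => ?_
    obtain ⟨u, v, rfl⟩ := Set.mem_iInter.1 hy a
    exact ⟨u, v * b, by simp only [mul_assoc]⟩
  · refine Set.mem_iInter.2 fun a => ?_
    obtain ⟨u, v, rfl⟩ := Set.mem_iInter.1 hy a
    exact ⟨b * u, v, by simp only [mul_assoc]⟩
  · rintro J ⟨a, ha⟩ hJ y hy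
    obtain ⟨u, v, rfl⟩ := Set.mem_iInter.1 hy a
    exact (hJ _ (hJ a ha u).2 v).1

end ZeroClosedPaper
end

section
/- A nonempty zero-closed semigroup X is polybounded if and only if X admits a separable subinvariant pseudometric d such that for some point o ∈ I := ⋂_{a∈X} XaX and some ε > 0 the set {x ∈ I : d(x,o) < ε} is polybounded in X. -/
open Cardinal Pointwise

universe u

namespace ZeroClosedPaper

/-- The functions `X → X` given by semigroup polynomials of positive degree. -/
inductive IsPolyFun {X : Type*} [Semigroup X] : (X → X) → Prop
  | id : IsPolyFun id
  | const_mul (a : X) {f : X → X} : IsPolyFun f → IsPolyFun (Function.const X a * f)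
  | mul_const (a : X) {f : X → X} : IsPolyFun f → IsPolyFun (f * Function.const X a)
  | mul {f g : X → X} : IsPolyFun f → IsPolyFun g → IsPolyFun (f * g)

section Polynomials

variable {X : Type*} [Semigroup X]

theorem IsPolyFun.comp {f g : X → X} (hf : IsPolyFun f) (hg : IsPolyFun g) :
    IsPolyFun (f ∘ g) := by
  induction hf with
  | id => exact hg
  | const_mul a _ ih => exact .const_mul a ih
  | mul_const a _ ih => exact .mul_const a ih
  | mul _ _ ih₁ ih₂ => exact .mul ih₁ ih₂

theorem polyVal_append_cons (s : List (WithOne X)) (a b : WithOne X) (t : List (WithOne X))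
    (x : X) : polyVal (s ++ (a * b) :: t) x = polyVal (s ++ [a]) x * polyVal (b :: t) x := by
  cases s <;> simp [polyVal, mul_assoc]

theorem IsPolyFun.exists_polyVal {f : X → X} (hf : IsPolyFun f) :
    ∃ a : List (WithOne X), 2 ≤ a.length ∧ ∀ x, polyVal a x = (f x : WithOne X) := by
  induction hf with
  | id => exact ⟨[1, 1], by simp, fun x => by simp [polyVal]⟩
  | @const_mul c f _ ih =>
    obtain ⟨a, ha, h⟩ := ih
    obtain ⟨a₀, t, rfl⟩ := List.exists_cons_of_length_pos (by omega : 0 < a.length)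
    refine ⟨(c * a₀) :: t, by simpa using ha, fun x => ?_⟩
    simp [← h, polyVal, mul_assoc]
  | @mul_const c f _ ih =>
    obtain ⟨a, ha, h⟩ := ih
    obtain rfl | ⟨s, e, rfl⟩ := a.eq_nil_or_concat
    · simp at ha
    refine ⟨s ++ [e * c], by simpa using ha, fun x => ?_⟩
    rw [polyVal_append_cons, ← List.concat_eq_append, h]
    simp [polyVal]
  | @mul f g _ _ ih₁ ih₂ =>
    obtain ⟨a, ha, h⟩ := ih₁
    obtain ⟨b, hb, h'⟩ := ih₂
    obtain rfl | ⟨s, e, rfl⟩ := a.eq_nil_or_concat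
    · simp at ha
    obtain ⟨b₀, t, rfl⟩ := List.exists_cons_of_length_pos (by omega : 0 < b.length)
    refine ⟨s ++ (e * b₀) :: t, ?_, fun x => ?_⟩
    · simp at ha hb ⊢
      omega
    · rw [polyVal_append_cons, ← List.concat_eq_append, h, h']
      simp

theorem exists_isPolyFun_prod (t : List (WithOne X)) (ht : t ≠ []) :
    ∃ f : X → X, IsPolyFun f ∧
      ∀ x : X, (t.map fun a => (x : WithOne X) * a).prod = (f x : WithOne X) := by
  have mul_coeff (a : WithOne X) :
      ∃ f : X → X, IsPolyFun f ∧ ∀ x : X, (x : WithOne X) * a = (f x : WithOne X) := by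
    induction a with
    | one => exact ⟨id, .id, fun x => by simp⟩
    | coe a => exact ⟨_, .mul_const a .id, fun x => by simp⟩
  induction t with
  | nil => exact absurd rfl ht
  | cons a t ih =>
    obtain ⟨f, hf, h⟩ := mul_coeff a
    rcases eq_or_ne t [] with rfl | hne
    · exact ⟨f, hf, fun x => by simp [h]⟩
    · obtain ⟨g, hg, h'⟩ := ih hne
      exact ⟨f * g, hf.mul hg, fun x => by simp [h, h']⟩

theorem exists_isPolyFun_polyVal (a : List (WithOne X)) (ha : 2 ≤ a.length) :
    ∃ f : X → X, IsPolyFun f ∧ ∀ x, polyVal a x = (f x : WithOne X) := by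
  match a, ha with
  | a₀ :: t, ha =>
    obtain ⟨f, hf, h⟩ := exists_isPolyFun_prod t (by rintro rfl; simp at ha)
    induction a₀ with
    | one => exact ⟨f, hf, fun x => by simp [polyVal, h]⟩
    | coe a₀ => exact ⟨_, .const_mul a₀ hf, fun x => by simp [polyVal, h]⟩

theorem isAlgebraicSet_iff {A : Set X} :
    IsAlgebraicSet A ↔ ∃ (f : X → X) (b : X), IsPolyFun f ∧ A = {x | f x = b} := by
  constructor
  · rintro ⟨a, b, ha, rfl⟩
    obtain ⟨f, hf, h⟩ := exists_isPolyFun_polyVal a ha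
    exact ⟨f, b, hf, by simp [h]⟩
  · rintro ⟨f, b, hf, rfl⟩
    obtain ⟨a, ha, h⟩ := hf.exists_polyVal
    exact ⟨a, b, ha, by simp [h]⟩

theorem IsAlgebraicSet.preimage {A : Set X} (hA : IsAlgebraicSet A) {f : X → X}
    (hf : IsPolyFun f) : IsAlgebraicSet (f ⁻¹' A) := by
  obtain ⟨g, b, hg, rfl⟩ := isAlgebraicSet_iff.1 hA
  exact isAlgebraicSet_iff.2 ⟨g ∘ f, b, hg.comp hf, rfl⟩

theorem PolyboundedIn.of_forall_exists_mem {S : Set X} (hS : PolyboundedIn S)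
    {F : Set (X → X)} (hF : F.Finite) (hpoly : ∀ f ∈ F, IsPolyFun f)
    (h : ∀ x, ∃ f ∈ F, f x ∈ S) : Polybounded X := by
  obtain ⟨C, hC, hCA, hSC⟩ := hS
  refine ⟨Set.image2 (fun f A => f ⁻¹' A) F C, hF.image2 _ hC, ?_, fun x _ => ?_⟩
  · rintro _ ⟨f, hf, A, hA, rfl⟩
    exact (hCA A hA).preimage (hpoly f hf)
  · obtain ⟨f, hf, hx⟩ := h x
    obtain ⟨A, hA, hxA⟩ := hSC hx
    exact ⟨_, ⟨f, hf, A, hA, rfl⟩, hxA⟩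

theorem IsPolyFun.exists_eq_mul_of_cube {f : X → X} (hf : IsPolyFun f) (a : X) :
    ∃ u v, u * a * v = f (a * a * a) := by
  induction hf with
  | id => exact ⟨a, a, rfl⟩
  | const_mul c _ ih =>
    obtain ⟨u, v, h⟩ := ih
    exact ⟨c * u, v, by rw [mul_assoc, mul_assoc, ← mul_assoc u, h]; rfl⟩
  | mul_const c _ ih =>
    obtain ⟨u, v, h⟩ := ih
    exact ⟨u, v * c, by rw [← mul_assoc, h]; rfl⟩
  | @mul f g _ _ ih _ =>
    obtain ⟨u, v, h⟩ := ih
    exact ⟨u, v * g (a * a * a), by rw [← mul_assoc, h]; rfl⟩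

theorem isIdeal_iInter_mul_mul :
    IsIdeal (⋂ a : X, {z : X | ∃ u v : X, u * a * v = z}) := by
  intro x hx c
  simp only [Set.mem_iInter, Set.mem_ofPred_eq] at hx ⊢
  constructor <;> intro a <;> obtain ⟨u, v, rfl⟩ := hx a
  · exact ⟨u, v * c, by simp only [mul_assoc]⟩
  · exact ⟨c * u, v, by simp only [mul_assoc]⟩

theorem exists_forall_mem_mul_mul_of_finite [Nonempty X] {B : Set X} (hB : B.Finite)
    (h : ∀ a : X, ∃ b ∈ B, ∃ u v : X, u * a * v = b) :
    ∃ b ∈ B, ∀ a : X, ∃ u v : X, u * a * v = b := by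
  by_contra! hne
  have key : ∀ T : Set X, T.Finite → T ⊆ B →
      ∃ a : X, ∀ b ∈ T, ∀ u v : X, u * a * v ≠ b := by
    intro T hT
    induction T, hT using Set.Finite.induction_on with
    | empty => exact fun _ => ⟨Classical.arbitrary X, by simp⟩
    | @insert b T _ _ ih =>
      intro hTB
      obtain ⟨a, ha⟩ := ih ((Set.subset_insert _ _).trans hTB)
      obtain ⟨a', ha'⟩ := hne b (hTB (Set.mem_insert _ _))
      refine ⟨a * a', ?_⟩
      rintro c (rfl | hc) u v
      · simpa only [mul_assoc] using ha' (u * a) v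
      · simpa only [mul_assoc] using ha c hc u (a' * v)
  obtain ⟨a, ha⟩ := key B hB subset_rfl
  obtain ⟨b, hb, u, v, huv⟩ := h a
  exact ha b hb u v huv

theorem Polybounded.nonempty_iInter_mul_mul [Nonempty X] (hX : Polybounded X) :
    (⋂ a : X, {z : X | ∃ u v : X, u * a * v = z}).Nonempty := by
  obtain ⟨C, hC, hCA, hcov⟩ := hX
  choose! f b hf hA using fun A hA => isAlgebraicSet_iff.1 (hCA A hA)
  obtain ⟨z, -, hz⟩ := exists_forall_mem_mul_mul_of_finite (hC.image b) fun a => by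
    obtain ⟨A, hAC, ha⟩ := hcov (Set.mem_univ (a * a * a))
    rw [hA A hAC] at ha
    refine ⟨b A, Set.mem_image_of_mem b hAC, ?_⟩
    rw [← show f A (a * a * a) = b A from ha]
    exact (hf A hAC).exists_eq_mul_of_cube a
  exact ⟨z, Set.mem_iInter.2 hz⟩

end Polynomials

section Words

variable {X : Type*} [Semigroup X]

/-- The functions obtained from the identity and the constants in `A` by at most `i` rounds of
pairwise multiplication. -/
def words (A : Set X) : ℕ → Set (X → X)
  | 0 => insert id (Function.const X '' A)
  | i + 1 => words A i ∪ words A i * words A i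

theorem finite_words {A : Set X} (hA : A.Finite) (i : ℕ) : (words A i).Finite := by
  induction i with
  | zero => exact (hA.image _).insert _
  | succ i ih => exact ih.union (ih.mul ih)

theorem words_mono (A : Set X) : Monotone (words A) :=
  monotone_nat_of_le_succ fun _ => Set.subset_union_left

theorem id_mem_words (A : Set X) (i : ℕ) : id ∈ words A i :=
  words_mono A i.zero_le (Set.mem_insert _ _)

theorem const_mem_words {A : Set X} {a : X} (ha : a ∈ A) (i : ℕ) :
    Function.const X a ∈ words A i :=
  words_mono A i.zero_le (Set.mem_insert_of_mem _ (Set.mem_image_of_mem _ ha))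

theorem mul_mem_words {A : Set X} {i j : ℕ} (hij : i < j) {f g : X → X} (hf : f ∈ words A i)
    (hg : g ∈ words A i) : f * g ∈ words A j :=
  words_mono A hij (Or.inr (Set.mul_mem_mul hf hg))

theorem const_apply_mem_words {A B : Set X} (hAB : A ⊆ B) {x : X} (hx : x ∈ B) {i : ℕ}
    {f : X → X} (hf : f ∈ words A i) : Function.const X (f x) ∈ words B i := by
  induction i generalizing f with
  | zero =>
    obtain rfl | ⟨a, ha, rfl⟩ := hf
    · exact const_mem_words hx 0
    · exact const_mem_words (hAB ha) 0
  | succ i ih =>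
    obtain hf | ⟨g, hg, h, hh, rfl⟩ := hf
    · exact Or.inl (ih hf)
    · exact Or.inr ⟨_, ih hg, _, ih hh, rfl⟩

/-- The decreasing sequence of sets generated by a sequence `x` of small elements and a sequence
`c` of multipliers: a product lies one level below its factors. -/
inductive Small (x c : ℕ → X) : ℕ → X → Prop
  | base {n k : ℕ} : n ≤ k → Small x c n (x k)
  | down {n : ℕ} {y : X} : Small x c (n + 1) y → Small x c n y
  | mul {n : ℕ} {y z : X} : Small x c (n + 1) y → Small x c (n + 1) z → Small x c n (y * z)
  | const_mul {n i : ℕ} {y : X} : i ≤ n → Small x c (n + 1) y → Small x c n (c i * y)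
  | mul_const {n i : ℕ} {y : X} : i ≤ n → Small x c (n + 1) y → Small x c n (y * c i)

theorem Small.anti {x c : ℕ → X} {m n : ℕ} (hmn : m ≤ n) {y : X} (h : Small x c n y) :
    Small x c m y := by
  induction hmn with
  | refl => exact h
  | step _ ih => exact ih h.down

theorem Small.mem_of_isIdeal {x c : ℕ → X} {I : Set X} (hI : IsIdeal I) (hx : ∀ k, x k ∈ I)
    {n : ℕ} {y : X} (h : Small x c n y) : y ∈ I := by
  induction h with
  | base => exact hx _
  | down _ ih => exact ih
  | mul _ _ ih _ => exact (hI _ ih _).1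
  | const_mul _ _ ih => exact (hI _ ih _).2
  | mul_const _ _ ih => exact (hI _ ih _).1

theorem Small.exists_word {x c : ℕ → X} {A : ℕ → Set X} (hA : Monotone A)
    (hx : ∀ k, x k ∈ A (k + 1)) (hc : ∀ k, c k ∈ A k) {n : ℕ} {y : X} (h : Small x c n y) :
    ∃ k f, n ≤ k ∧ IsPolyFun f ∧ f ∈ words (A k) (k - n) ∧ f (x k) = y := by
  induction h with
  | @base n k hk => exact ⟨k, id, hk, .id, id_mem_words _ _, rfl⟩
  | down _ ih =>
    obtain ⟨k, f, hk, hf, hfw, rfl⟩ := ih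
    exact ⟨k, f, by omega, hf, words_mono _ (by omega) hfw, rfl⟩
  | @mul n y z _ _ ih₁ ih₂ =>
    obtain ⟨k, f, hk, hf, hfw, rfl⟩ := ih₁
    obtain ⟨l, g, hl, hg, hgw, rfl⟩ := ih₂
    rcases lt_trichotomy k l with hkl | rfl | hlk
    · refine ⟨l, _, by omega, .const_mul (f (x k)) hg, mul_mem_words
        (i := l - (n + 1)) (by omega) ?_ hgw, rfl⟩
      exact words_mono _ (by omega)
        (const_apply_mem_words (hA hkl.le) (hA (Nat.succ_le_of_lt hkl) (hx k)) hfw)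
    · exact ⟨k, f * g, by omega, hf.mul hg, mul_mem_words (by omega) hfw hgw, rfl⟩
    · refine ⟨k, _, by omega, .mul_const (g (x l)) hf, mul_mem_words
        (i := k - (n + 1)) (by omega) hfw ?_, rfl⟩
      exact words_mono _ (by omega)
        (const_apply_mem_words (hA hlk.le) (hA (Nat.succ_le_of_lt hlk) (hx l)) hgw)
  | @const_mul n i y hi _ ih =>
    obtain ⟨k, f, hk, hf, hfw, rfl⟩ := ih
    exact ⟨k, _, by omega, .const_mul (c i) hf, mul_mem_words (by omega)
      (const_mem_words (hA (by omega) (hc i)) _) hfw, rfl⟩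
  | @mul_const n i y hi _ ih =>
    obtain ⟨k, f, hk, hf, hfw, rfl⟩ := ih
    exact ⟨k, _, by omega, .mul_const (c i) hf, mul_mem_words (by omega) hfw
      (const_mem_words (hA (by omega) (hc i)) _), rfl⟩

theorem exists_seq_small_notMem (hX : ¬ Polybounded X) {I S : Set X} (hI : IsIdeal I)
    (hIne : I.Nonempty) (hS : PolyboundedIn S) (c : ℕ → X) :
    ∃ x : ℕ → X, ∀ n y, Small x c n y → y ∈ I ∧ y ∉ S := by
  classical
  obtain ⟨o, ho⟩ := hIne
  have step (k : ℕ) (A : Finset X) :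
      ∃ x ∈ I, ∀ f ∈ words (A : Set X) k, IsPolyFun f → f x ∉ S := by
    by_contra! hcon
    refine hX (hS.of_forall_exists_mem
      (F := (fun f => f ∘ (id * Function.const X o)) '' {f ∈ words (A : Set X) k | IsPolyFun f})
      (((finite_words A.finite_toSet k).subset (Set.sep_subset _ _)).image _) ?_ fun y => ?_)
    · rintro _ ⟨f, hf, rfl⟩
      exact hf.2.comp (.mul_const o .id)
    · obtain ⟨f, hfw, hf, hfS⟩ := hcon (y * o) (hI o ho y).2
      exact ⟨_, ⟨f, ⟨hfw, hf⟩, rfl⟩, hfS⟩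
  choose p hpI hpS using step
  obtain ⟨A, hA₀, hA₁⟩ : ∃ A : ℕ → Finset X, A 0 = {c 0} ∧
      ∀ k, A (k + 1) = insert (p k (A k)) (insert (c (k + 1)) (A k)) :=
    ⟨fun k => Nat.rec {c 0} (fun k A => insert (p k A) (insert (c (k + 1)) A)) k,
      rfl, fun _ => rfl⟩
  have hA : Monotone fun k => (A k : Set X) := monotone_nat_of_le_succ fun k => by
    simp only [hA₁, Finset.coe_insert]
    exact (Set.subset_insert _ _).trans (Set.subset_insert _ _)
  have hx (k : ℕ) : p k (A k) ∈ (A (k + 1) : Set X) := by simp [hA₁]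
  have hc (k : ℕ) : c k ∈ (A k : Set X) := by cases k <;> simp [hA₀, hA₁]
  refine ⟨fun k => p k (A k), fun n y h => ⟨h.mem_of_isIdeal hI fun k => hpI k _, ?_⟩⟩
  obtain ⟨k, f, -, hf, hfw, rfl⟩ := h.exists_word hA hx hc
  exact hpS k (A k) f (words_mono _ (Nat.sub_le k n) hfw) hf

end Words

section Topology

open Filter Topology

variable {X : Type*} [Semigroup X]

/-- A filter on a zero-closed semigroup along which every element behaves like a zero is trivial:
otherwise it would converge to `0` in a Hausdorff semigroup topology with `X` discrete. -/
theorem ZeroClosed.eq_bot_of_tendsto (hz : ZeroClosed X) {l : Filter X}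
    (hne : ∀ b : X, ∀ᶠ y in l, y ≠ b) (hleft : ∀ a : X, Tendsto (a * ·) l l)
    (hright : ∀ a : X, Tendsto (· * a) l l)
    (hmul : Tendsto (fun q : X × X => q.1 * q.2) (l ×ˢ l) l) : l = ⊥ := by
  let τ : TopologicalSpace (WithZero X) := nhdsAdjoint 0 (l.map (↑))
  have nhds_zero : 𝓝 (0 : WithZero X) = pure 0 ⊔ l.map (↑) := nhds_nhdsAdjoint_same _ _
  have nhds_coe (x : X) : 𝓝 (x : WithZero X) = pure (x : WithZero X) :=
    nhds_nhdsAdjoint_of_ne _ WithZero.coe_ne_zero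
  have disj (b : X) : Disjoint (𝓝 (b : WithZero X)) (𝓝 0) := by
    rw [nhds_coe, disjoint_comm, nhds_zero, disjoint_sup_left]
    constructor
    · exact disjoint_pure_pure.2 WithZero.coe_ne_zero.symm
    · rw [← principal_singleton, disjoint_principal_right, mem_map]
      filter_upwards [hne b] with y hy
      simpa using hy
  have hT2 : T2Space (WithZero X) := t2Space_iff_disjoint_nhds.2 fun p q hpq => by
    induction p with
    | zero =>
      induction q with
      | zero => exact absurd rfl hpq
      | coe q => exact (disj q).symm
    | coe p =>
      induction q with
      | zero => exact disj p
      | coe q => simpa [nhds_coe] using hpq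
  have le_zero : l.map (↑) ≤ 𝓝 (0 : WithZero X) := nhds_zero ▸ le_sup_right
  have hcont : ContinuousMul (WithZero X) := by
    refine ⟨continuous_iff_continuousAt.2 ?_⟩
    rintro ⟨p, q⟩
    simp only [ContinuousAt, nhds_prod_eq]
    induction p with
    | zero =>
      induction q with
      | zero =>
        rw [mul_zero]
        nth_rw 1 2 [nhds_zero]
        simp only [sup_prod, prod_sup, tendsto_sup]
        refine ⟨⟨?_, ?_⟩, ?_, ?_⟩
        · simp [Tendsto]
        · simpa [pure_prod, tendsto_map'_iff, Function.comp_def] using tendsto_const_nhds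
        · simpa [prod_pure, tendsto_map'_iff, Function.comp_def] using tendsto_const_nhds
        · rw [prod_map_map_eq, tendsto_map'_iff]
          exact (tendsto_map.mono_right le_zero).comp hmul
      | coe q =>
        rw [nhds_coe, zero_mul, prod_pure, tendsto_map'_iff]
        nth_rw 1 [nhds_zero]
        refine Tendsto.sup ?_ ?_
        · exact tendsto_pure_left.2 fun s hs => by simpa using mem_of_mem_nhds hs
        · rw [tendsto_map'_iff]
          exact (tendsto_map.mono_right le_zero).comp (hright q)
    | coe p =>
      induction q with
      | zero =>
        rw [nhds_coe, mul_zero, pure_prod, tendsto_map'_iff]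
        nth_rw 1 [nhds_zero]
        refine Tendsto.sup ?_ ?_
        · exact tendsto_pure_left.2 fun s hs => by simpa using mem_of_mem_nhds hs
        · rw [tendsto_map'_iff]
          exact (tendsto_map.mono_right le_zero).comp (hleft p)
      | coe q =>
        rw [nhds_coe, nhds_coe, prod_pure_pure, tendsto_pure_left]
        exact fun s hs => mem_of_mem_nhds hs
  have hclosed := hz τ hT2 hcont
  have hmem : (Set.range ((↑) : X → WithZero X))ᶜ ∈ 𝓝 (0 : WithZero X) :=
    hclosed.isOpen_compl.mem_nhds (by simp)
  rw [← empty_mem_iff_bot]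
  filter_upwards [mem_map.1 (le_zero hmem)] with y hy
  exact hy ⟨y, rfl⟩

end Topology

section Pseudometric

open Filter Topology

variable {X : Type*} [Semigroup X]

theorem Subinvariant.mul_le {d : X → X → ℝ} (hd : IsPseudometric d) (hs : Subinvariant d)
    (x x' y y' : X) : d (x * y) (x' * y') ≤ d x x' + d y y' :=
  (hd.2.2 _ (x' * y) _).trans (add_le_add (hs.2 y x x') (hs.1 x' y y'))

theorem ZeroClosed.exists_small_close (hz : ZeroClosed X) {d : X → X → ℝ}
    (hd : IsPseudometric d) (hs : Subinvariant d) {c : ℕ → X}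
    (hc : ∀ x : X, ∀ ε : ℝ, 0 < ε → ∃ i, d x (c i) < ε) (x : ℕ → X) {o : X}
    (ho : ∀ a : X, ∃ u v : X, u * a * v = o) {ε : ℝ} (hε : 0 < ε) :
    ∃ n y, Small x c n y ∧ d y o < ε := by
  by_contra! hfar
  let U : ℕ → Set X := fun n => {y | ∃ u, Small x c n u ∧ d y u < (1 / 2) ^ n}
  have hU : Antitone U := fun m n hmn y ⟨u, hu, hyu⟩ =>
    ⟨u, hu.anti hmn, hyu.trans_le (pow_le_pow_of_le_one (by norm_num) (by norm_num) hmn)⟩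
  have hbasis : (⨅ n, 𝓟 (U n)).HasBasis (fun _ => True) U :=
    hasBasis_iInf_principal hU.directed_ge
  have half (n : ℕ) : (1 / 2 : ℝ) ^ (n + 1) + (1 / 2) ^ (n + 1) = (1 / 2) ^ n := by ring
  have hleft (a : X) : Tendsto (a * ·) (⨅ n, 𝓟 (U n)) (⨅ n, 𝓟 (U n)) := by
    refine (hbasis.tendsto_iff hbasis).2 fun n _ => ?_
    obtain ⟨i, hi⟩ := hc a ((1 / 2) ^ (n + 1)) (by positivity)
    refine ⟨max n i + 1, trivial, fun y ⟨u, hu, hyu⟩ =>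
      ⟨c i * u, (Small.const_mul (le_max_right n i) hu).anti (le_max_left n i), ?_⟩⟩
    have : (1 / 2 : ℝ) ^ (max n i + 1) ≤ (1 / 2) ^ (n + 1) :=
      pow_le_pow_of_le_one (by norm_num) (by norm_num) (by omega)
    linarith [hs.mul_le hd a (c i) y u, half n]
  have hright (a : X) : Tendsto (· * a) (⨅ n, 𝓟 (U n)) (⨅ n, 𝓟 (U n)) := by
    refine (hbasis.tendsto_iff hbasis).2 fun n _ => ?_
    obtain ⟨i, hi⟩ := hc a ((1 / 2) ^ (n + 1)) (by positivity)
    refine ⟨max n i + 1, trivial, fun y ⟨u, hu, hyu⟩ =>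
      ⟨u * c i, (Small.mul_const (le_max_right n i) hu).anti (le_max_left n i), ?_⟩⟩
    have : (1 / 2 : ℝ) ^ (max n i + 1) ≤ (1 / 2) ^ (n + 1) :=
      pow_le_pow_of_le_one (by norm_num) (by norm_num) (by omega)
    linarith [hs.mul_le hd y u a (c i), half n]
  have hmul : Tendsto (fun q : X × X => q.1 * q.2)
      ((⨅ n, 𝓟 (U n)) ×ˢ ⨅ n, 𝓟 (U n)) (⨅ n, 𝓟 (U n)) := by
    refine (hbasis.prod_self.tendsto_iff hbasis).2 fun n _ => ⟨n + 1, trivial, ?_⟩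
    rintro ⟨y, z⟩ ⟨⟨u, hu, hyu⟩, v, hv, hzv⟩
    refine ⟨u * v, hu.mul hv, ?_⟩
    linarith [hs.mul_le hd y u z v, half n]
  have hne_o : ∀ᶠ y in ⨅ n, 𝓟 (U n), y ≠ o := by
    obtain ⟨n, hn⟩ := exists_pow_lt_of_lt_one hε (by norm_num : (1 / 2 : ℝ) < 1)
    filter_upwards [hbasis.mem_of_mem (i := n) trivial]
    rintro _ ⟨u, hu, hou⟩ rfl
    rw [hd.2.1] at hou
    linarith [hfar n u hu]
  have hne (b : X) : ∀ᶠ y in ⨅ n, 𝓟 (U n), y ≠ b := by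
    obtain ⟨u, v, rfl⟩ := ho b
    filter_upwards [((hright v).comp (hleft u)).eventually hne_o]
    rintro _ hy rfl
    exact hy rfl
  obtain ⟨n, -, hn⟩ := hbasis.mem_iff.1
    (empty_mem_iff_bot.2 (hz.eq_bot_of_tendsto hne hleft hright hmul))
  exact hn ⟨x n, .base le_rfl, by rw [hd.1]; positivity⟩

end Pseudometric

/-- A nonempty zero-closed semigroup `X` is polybounded iff it admits a
separable subinvariant pseudometric `d` such that for some `o ∈ I = ⋂_{a∈X} XaX`
and some `ε > 0` the set `{x ∈ I : d(x,o) < ε}` is polybounded in `X`. -/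
theorem statement2 {X : Type u} [Semigroup X] [Nonempty X] (hz : ZeroClosed X) :
    Polybounded X ↔
      ∃ d : X → X → ℝ, IsPseudometric d ∧ SeparablePseudometric d ∧ Subinvariant d ∧
        ∃ o ∈ ⋂ a : X, {z : X | ∃ u v : X, u * a * v = z}, ∃ ε : ℝ, 0 < ε ∧
          PolyboundedIn {x ∈ ⋂ a : X, {z : X | ∃ u v : X, u * a * v = z} | d x o < ε} := by
  constructor
  · intro hX
    obtain ⟨o, ho⟩ := hX.nonempty_iInter_mul_mul
    obtain ⟨C, hC, hCA, hcov⟩ := hX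
    exact ⟨fun _ _ => 0, ⟨by simp, by simp, by simp⟩,
      ⟨{o}, Set.countable_singleton o, fun _ ε hε => ⟨o, rfl, hε⟩⟩, ⟨by simp, by simp⟩,
      o, ho, 1, one_pos, C, hC, hCA, (Set.subset_univ _).trans hcov⟩
  · rintro ⟨d, hd, ⟨D, hD, hdense⟩, hs, o, ho, ε, hε, hS⟩
    by_contra hX
    obtain ⟨z, hzD, -⟩ := hdense o 1 one_pos
    obtain ⟨c, rfl⟩ := hD.exists_eq_range ⟨z, hzD⟩
    obtain ⟨x, hx⟩ := exists_seq_small_notMem hX isIdeal_iInter_mul_mul ⟨o, ho⟩ hS c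
    obtain ⟨n, y, hy, hyo⟩ := hz.exists_small_close hd hs
      (fun a δ hδ => by simpa using hdense a δ hδ) x (Set.mem_iInter.1 ho) hε
    exact (hx n y hy).2 ⟨(hx n y hy).1, hyo⟩

end ZeroClosedPaper
end

section
/- Assume cov(M) = 𝔠, i.e., the real line is not the union of fewer than continuum many meager sets. Every zero-closed semigroup X admitting a compact Hausdorff semigroup topology is polybounded. -/
open Cardinal Pointwise

universe u

namespace ZeroClosedPaper

open Filter Topology

/-- A filter on a semigroup which can serve as the trace of the neighborhood filter of the
non-isolated zero of the `0`-extension whose nonzero points are isolated. -/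
structure IsZeroFilter {X : Type*} [Semigroup X] (F : Filter X) : Prop where
  neBot : F.NeBot
  compl_singleton_mem : ∀ x, {x}ᶜ ∈ F
  tendsto_mul_left : ∀ x, Tendsto (fun y => x * y) F F
  tendsto_mul_right : ∀ x, Tendsto (fun y => y * x) F F
  tendsto_mul : Tendsto (fun p : X × X => p.1 * p.2) (F ×ˢ F) F

theorem IsZeroFilter.comap {X Y : Type*} [Semigroup X] [Semigroup Y] {F : Filter Y}
    (hF : IsZeroFilter F) (φ : X →ₙ* Y) (hφ : Function.Surjective φ) :
    IsZeroFilter (F.comap φ) where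
  neBot := hF.neBot.comap_of_surj hφ
  compl_singleton_mem x := ⟨{φ x}ᶜ, hF.compl_singleton_mem _, by
    rintro y hy rfl
    exact hy rfl⟩
  tendsto_mul_left x := by
    rw [tendsto_comap_iff]
    simpa [Function.comp_def] using (hF.tendsto_mul_left (φ x)).comp tendsto_comap
  tendsto_mul_right x := by
    rw [tendsto_comap_iff]
    simpa [Function.comp_def] using (hF.tendsto_mul_right (φ x)).comp tendsto_comap
  tendsto_mul := by
    rw [tendsto_comap_iff]
    simpa [Function.comp_def] using
      hF.tendsto_mul.comp
        ((tendsto_comap (f := φ) (x := F)).prodMap (tendsto_comap (f := φ) (x := F)))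

theorem ZeroClosed.not_isZeroFilter {X : Type*} [Semigroup X] (hz : ZeroClosed X) (F : Filter X) :
    ¬ IsZeroFilter F := by
  intro hF
  have := hF.neBot
  let τ : TopologicalSpace (WithZero X) := nhdsAdjoint 0 (F.map (↑))
  have h0 : 𝓝 (0 : WithZero X) = pure 0 ⊔ F.map (↑) := nhds_nhdsAdjoint_same _ _
  have hx : ∀ x : X, 𝓝 (x : WithZero X) = pure (x : WithZero X) := fun x =>
    nhds_nhdsAdjoint_of_ne _ WithZero.coe_ne_zero
  have hsep : ∀ x : X, Disjoint (𝓝 (x : WithZero X)) (𝓝 0) := by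
    intro x
    rw [hx, h0, Filter.disjoint_iff]
    refine ⟨{(x : WithZero X)}, rfl, {(x : WithZero X)}ᶜ, mem_sup.2 ⟨?_, ?_⟩,
      disjoint_compl_right⟩
    · exact mem_pure.2 fun h => WithZero.coe_ne_zero (Set.mem_singleton_iff.1 h).symm
    · rw [mem_map]
      filter_upwards [hF.compl_singleton_mem x] with y hy
      simpa using hy
  have hT2 : T2Space (WithZero X) := by
    rw [t2Space_iff_disjoint_nhds]
    intro a b hab
    induction a using WithZero.recZeroCoe with
    | zero =>
      induction b using WithZero.recZeroCoe with
      | zero => exact absurd rfl hab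
      | coe b => exact (hsep b).symm
    | coe a =>
      induction b using WithZero.recZeroCoe with
      | zero => exact hsep a
      | coe b => rw [hx, hx]; simpa using hab
  have hmul : ContinuousMul (WithZero X) := by
    refine ⟨continuous_iff_continuousAt.2 ?_⟩
    rintro ⟨a, b⟩
    rw [ContinuousAt, nhds_prod_eq]
    have hF0 : Tendsto ((↑) : X → WithZero X) F (𝓝 0) := by
      rw [h0]; exact tendsto_map.mono_right le_sup_right
    have hl : ∀ G : Filter (WithZero X),
        Tendsto (fun p : WithZero X × WithZero X => p.1 * p.2) (pure 0 ×ˢ G) (𝓝 0) := by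
      intro G
      rw [pure_prod, tendsto_map'_iff]
      simpa [Function.comp_def] using tendsto_const_nhds
    have hr : ∀ G : Filter (WithZero X),
        Tendsto (fun p : WithZero X × WithZero X => p.1 * p.2) (G ×ˢ pure 0) (𝓝 0) := by
      intro G
      rw [prod_pure, tendsto_map'_iff]
      simpa [Function.comp_def] using tendsto_const_nhds
    have hprod : Tendsto (fun p : WithZero X × WithZero X => p.1 * p.2)
        (F.map (↑) ×ˢ F.map (↑)) (𝓝 0) := by
      rw [prod_map_map_eq, tendsto_map'_iff]
      simpa [Function.comp_def] using hF0.comp hF.tendsto_mul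
    have hleft : ∀ x : X, Tendsto (fun p : WithZero X × WithZero X => p.1 * p.2)
        (pure (x : WithZero X) ×ˢ F.map (↑)) (𝓝 0) := by
      intro x
      rw [pure_prod, tendsto_map'_iff, tendsto_map'_iff]
      simpa [Function.comp_def] using hF0.comp (hF.tendsto_mul_left x)
    have hright : ∀ x : X, Tendsto (fun p : WithZero X × WithZero X => p.1 * p.2)
        (F.map (↑) ×ˢ pure (x : WithZero X)) (𝓝 0) := by
      intro x
      rw [prod_pure, tendsto_map'_iff, tendsto_map'_iff]
      simpa [Function.comp_def] using hF0.comp (hF.tendsto_mul_right x)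
    have h00 : Tendsto (fun p : WithZero X × WithZero X => p.1 * p.2) (𝓝 0 ×ˢ 𝓝 0) (𝓝 0) := by
      have h : Tendsto (fun p : WithZero X × WithZero X => p.1 * p.2)
          ((pure 0 ⊔ F.map (↑)) ×ˢ (pure 0 ⊔ F.map (↑))) (𝓝 0) := by
        rw [sup_prod]
        refine Tendsto.sup (hl _) ?_
        rw [prod_sup]
        exact Tendsto.sup (hr _) hprod
      rwa [← h0] at h
    have hx0 : ∀ x : X, Tendsto (fun p : WithZero X × WithZero X => p.1 * p.2)
        (𝓝 (x : WithZero X) ×ˢ 𝓝 0) (𝓝 0) := by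
      intro x
      have h : Tendsto (fun p : WithZero X × WithZero X => p.1 * p.2)
          (pure (x : WithZero X) ×ˢ (pure 0 ⊔ F.map (↑))) (𝓝 0) := by
        rw [prod_sup]
        exact Tendsto.sup (hr _) (hleft x)
      rwa [← h0, ← hx] at h
    have h0x : ∀ x : X, Tendsto (fun p : WithZero X × WithZero X => p.1 * p.2)
        (𝓝 0 ×ˢ 𝓝 (x : WithZero X)) (𝓝 0) := by
      intro x
      have h : Tendsto (fun p : WithZero X × WithZero X => p.1 * p.2)
          ((pure 0 ⊔ F.map (↑)) ×ˢ pure (x : WithZero X)) (𝓝 0) := by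
        rw [sup_prod]
        exact Tendsto.sup (hl _) (hright x)
      rwa [← h0, ← hx] at h
    induction a using WithZero.recZeroCoe with
    | zero =>
      induction b using WithZero.recZeroCoe with
      | zero => simpa only [mul_zero] using h00
      | coe b => simpa only [zero_mul] using h0x b
    | coe a =>
      induction b using WithZero.recZeroCoe with
      | zero => simpa only [mul_zero] using hx0 a
      | coe b =>
        rw [hx, hx, prod_pure_pure]
        exact tendsto_pure_left.2 fun s hs => mem_of_mem_nhds hs
  have hcl := (hz τ hT2 hmul).isOpen_compl.mem_nhds
    (show (0 : WithZero X) ∈ (Set.range ((↑) : X → WithZero X))ᶜ by simp)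
  rw [h0, mem_sup, mem_map] at hcl
  obtain ⟨x, hx⟩ := this.nonempty_of_mem hcl.2
  exact hx ⟨x, rfl⟩

theorem exists_sequence_of_codes : ∃ c : ℕ → ℝ → ℕ, ∀ U : Set ℝ, IsOpen U → U.Nonempty →
    ∃ n, ∃ V ⊆ U, V.Nonempty ∧ (∀ i < n, ∀ r ∈ V, ∀ s ∈ V, c i r = c i s) ∧
      ∀ k, ∃ W ⊆ V, IsOpen W ∧ W.Nonempty ∧ ∀ r ∈ W, c n r = k := by
  obtain ⟨q, hq⟩ := exists_surjective_nat ℚ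
  refine ⟨fun n r => (⌊√2 / |r - q n|⌋₊).unpair.1, fun U hU hne => ?_⟩
  have hex : ∃ n, (q n : ℝ) ∈ U := by
    obtain ⟨x, hx, y, rfl⟩ := Rat.denseRange_cast.inter_open_nonempty U hU hne
    obtain ⟨n, rfl⟩ := hq y
    exact ⟨n, hx⟩
  classical
  obtain ⟨n, hn, hmin⟩ : ∃ n, (q n : ℝ) ∈ U ∧ ∀ i < n, (q i : ℝ) ∉ U :=
    ⟨Nat.find hex, Nat.find_spec hex, fun i hi => Nat.find_min hex hi⟩
  have hloc : ∀ i < n, ∀ᶠ r : ℝ in 𝓝 (q n : ℝ),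
      ⌊√2 / |r - q i|⌋₊ = ⌊√2 / |(q n : ℝ) - q i|⌋₊ := by
    intro i hi
    have hne : q n - q i ≠ 0 := fun h => hmin i hi (by rwa [← sub_eq_zero.1 h])
    have habs : |(q n : ℝ) - q i| = ((|q n - q i| : ℚ) : ℝ) := by push_cast; rfl
    have hpos : |(q n : ℝ) - q i| ≠ 0 := by
      rw [habs]; exact_mod_cast abs_ne_zero.2 hne
    have hirr : Irrational (√2 / |(q n : ℝ) - q i|) := by
      rw [habs]; exact irrational_sqrt_two.div_ratCast (abs_ne_zero.2 hne)
    have hcont : ContinuousAt (fun r : ℝ => √2 / |r - q i|) (q n) :=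
      continuousAt_const.div (by fun_prop) hpos
    have h0 : 0 ≤ √2 / |(q n : ℝ) - q i| := by positivity
    have hlt : (⌊√2 / |(q n : ℝ) - q i|⌋₊ : ℝ) < √2 / |(q n : ℝ) - q i| :=
      lt_of_le_of_ne (Nat.floor_le h0) fun h => hirr.ne_nat _ h.symm
    filter_upwards [hcont.eventually (Ioo_mem_nhds hlt (Nat.lt_floor_add_one _))] with r hr
    exact (Nat.floor_eq_iff (by positivity)).2 ⟨hr.1.le, hr.2⟩
  have hV : ∀ᶠ r : ℝ in 𝓝 (q n : ℝ), r ∈ U ∧ ∀ i < n,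
      ⌊√2 / |r - q i|⌋₊ = ⌊√2 / |(q n : ℝ) - q i|⌋₊ := by
    refine (hU.eventually_mem hn).and ?_
    exact (Set.finite_lt_nat n).eventually_all.2 hloc
  obtain ⟨ε, hε, hball⟩ := Metric.eventually_nhds_iff_ball.1 hV
  refine ⟨n, Metric.ball (q n : ℝ) ε, fun r hr => (hball r hr).1, ⟨_, Metric.mem_ball_self hε⟩,
    fun i hi r hr s hs => by simp only [(hball r hr).2 i hi, (hball s hs).2 i hi], fun k => ?_⟩
  obtain ⟨j, hj⟩ := exists_nat_gt (√2 / ε)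
  have h2 : 0 < √2 := by positivity
  have hM : √2 / ε < Nat.pair k j := hj.trans_le (by exact_mod_cast Nat.right_le_pair k j)
  set M := Nat.pair k j with hMdef
  have hM0 : (0 : ℝ) < M := lt_trans (by positivity) hM
  have hlt : √2 / (M + 1) < √2 / M := div_lt_div_of_pos_left h2 hM0 (by linarith)
  have hMε : √2 / M < ε := by
    rw [div_lt_iff₀ hε] at hM
    rw [div_lt_iff₀ hM0]; linarith
  refine ⟨Set.Ioo (q n + √2 / (M + 1)) (q n + √2 / M), fun r hr => ?_, isOpen_Ioo,
    Set.nonempty_Ioo.2 (by linarith), fun r hr => ?_⟩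
  · have : 0 < √2 / ((M : ℝ) + 1) := by positivity
    rw [Metric.mem_ball, Real.dist_eq, abs_of_pos] <;> linarith [hr.1, hr.2]
  · have h1 : √2 / (M + 1) < r - q n := by linarith [hr.1]
    have h3 : r - q n < √2 / M := by linarith [hr.2]
    have hpos : 0 < r - q n := lt_trans (by positivity) h1
    have : ⌊√2 / |r - q n|⌋₊ = M := by
      rw [abs_of_pos hpos, Nat.floor_eq_iff (by positivity)]
      constructor
      · rw [le_div_iff₀ hpos]
        rw [lt_div_iff₀ hM0] at h3
        linarith
      · rw [div_lt_iff₀ hpos]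
        rw [div_lt_iff₀ (by positivity)] at h1
        linarith
    simp [this, hMdef]

theorem covMeager_le_mk {ι : Type u} (S : ι → Set ℝ) (hS : ∀ i, IsMeagre (S i))
    (hcov : ∀ r, ∃ i, r ∈ S i) : Cardinal.lift.{u} covMeager ≤ #ι := by
  have h : covMeager ≤ #(Set.range S) := csInf_le' ⟨Set.range S, by rintro _ ⟨i, rfl⟩; exact hS i,
    by simpa [Set.eq_univ_iff_forall] using hcov, rfl⟩
  simpa using (Cardinal.lift_le.2 h).trans mk_range_le_lift

theorem exists_notMem_of_mk_lt_covMeager {Z ι : Type u} [TopologicalSpace Z] [CompactSpace Z]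
    [T2Space Z] [SecondCountableTopology Z] [Nonempty Z] (A : ι → Set Z)
    (hcl : ∀ i, IsClosed (A i)) (hint : ∀ i, interior (A i) = ∅)
    (hι : #ι < Cardinal.lift.{u} covMeager) : ∃ z, ∀ i, z ∉ A i := by
  obtain ⟨c, hc⟩ := exists_sequence_of_codes
  obtain ⟨B, hB⟩ : ∃ B : ℕ → Set Z, TopologicalSpace.IsTopologicalBasis (Set.range B) := by
    obtain ⟨b, hbc, -, hb⟩ := TopologicalSpace.exists_countable_basis Z
    obtain ⟨B, rfl⟩ := hbc.exists_eq_range (by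
      obtain ⟨s, hs, -⟩ := hb.exists_subset_of_mem_open (Set.mem_univ (Classical.arbitrary Z))
        isOpen_univ
      exact ⟨s, hs⟩)
    exact ⟨B, hb⟩
  classical
  let O : ℝ → ℕ → Set Z := fun r n => Nat.rec (motive := fun _ => Set Z) Set.univ
    (fun n (P : Set Z) => if (B (c n r)).Nonempty ∧ closure (B (c n r)) ⊆ P then B (c n r) else P) n
  have hO1 : ∀ (r : ℝ) (n : ℕ), O r (n + 1) = if (B (c n r)).Nonempty ∧ closure (B (c n r)) ⊆ O r n
      then B (c n r) else O r n := fun _ _ => rfl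
  have hOo : ∀ r n, IsOpen (O r n) ∧ (O r n).Nonempty := by
    intro r n
    induction n with
    | zero => exact ⟨isOpen_univ, Set.univ_nonempty⟩
    | succ n ih =>
      rw [hO1]
      split_ifs with h
      · exact ⟨hB.isOpen ⟨_, rfl⟩, h.1⟩
      · exact ih
  have hanti : ∀ r n, O r (n + 1) ⊆ O r n := by
    intro r n
    rw [hO1]
    split_ifs with h
    · exact subset_closure.trans h.2
    · rfl
  have hpt : ∀ r, ∃ z, ∀ n, z ∈ closure (O r n) := by
    intro r
    obtain ⟨z, hz⟩ := IsCompact.nonempty_iInter_of_sequence_nonempty_isCompact_isClosed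
      (fun n => closure (O r n)) (fun n => closure_mono (hanti r n)) (fun n => (hOo r n).2.closure)
      isClosed_closure.isCompact (fun n => isClosed_closure)
    exact ⟨z, Set.mem_iInter.1 hz⟩
  choose φ hφ using hpt
  by_contra! hcov
  refine hι.not_ge (covMeager_le_mk (fun i => φ ⁻¹' A i) (fun i => ?_) fun r => hcov (φ r))
  refine IsNowhereDense.isMeagre ?_
  by_contra hnd
  obtain ⟨n, V, hVU, ⟨v, hv⟩, hconst, hW⟩ :=
    hc _ isOpen_interior (Set.nonempty_iff_ne_empty.2 hnd)
  have hOV : ∀ r ∈ V, ∀ m ≤ n, O r m = O v m := by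
    intro r hr m
    induction m with
    | zero => intro _; rfl
    | succ m ih =>
      intro hm
      rw [hO1, hO1, ih (by omega), hconst m hm r hr v hv]
  obtain ⟨z, hz, hzA⟩ : (O v n \ A i).Nonempty := by
    by_contra hemp
    rw [Set.not_nonempty_iff_eq_empty, Set.sdiff_eq_empty] at hemp
    have := interior_maximal hemp (hOo v n).1
    rw [hint i] at this
    exact (hOo v n).2.ne_empty (Set.subset_empty_iff.1 this)
  have hnhd : O v n \ A i ∈ 𝓝 z := ((hOo v n).1.sdiff (hcl i)).mem_nhds ⟨hz, hzA⟩
  obtain ⟨K, hK, hKcl, hKO⟩ := exists_mem_nhds_isClosed_subset hnhd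
  obtain ⟨_, ⟨k, rfl⟩, hzk, hkK⟩ := hB.mem_nhds_iff.1 hK
  have hkO : closure (B k) ⊆ O v n \ A i := (closure_minimal hkK hKcl).trans hKO
  obtain ⟨W, hWV, hWo, ⟨w, hw⟩, hWk⟩ := hW k
  obtain ⟨y, hyW, hyA⟩ := mem_closure_iff.1 (interior_subset (hVU (hWV hw))) W hWo hw
  have hOy : O y (n + 1) = B k := by
    rw [hO1, hWk y hyW, hOV y (hWV hyW) n le_rfl, if_pos ⟨⟨z, hzk⟩, hkO.trans Set.sdiff_subset⟩]
  have hφy := hφ y (n + 1)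
  rw [hOy] at hφy
  exact (hkO hφy).2 hyA

/-- A compact Hausdorff semigroup contains an idempotent `e` such that `eYe` is a group. -/
theorem exists_idempotent_forall_exists_mul_eq {Y : Type*} [Semigroup Y] [TopologicalSpace Y]
    [CompactSpace Y] [T2Space Y] [ContinuousMul Y] [Nonempty Y] :
    ∃ e : Y, e * e = e ∧ ∀ h, e * h = h → h * e = h → ∃ g, e * g = g ∧ g * e = g ∧ g * h = e := by
  let S : Set (Set Y) := {L | IsClosed L ∧ L.Nonempty ∧ ∀ a, ∀ x ∈ L, a * x ∈ L}
  obtain ⟨L, -, hL⟩ := zorn_superset_nonempty S (by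
    intro C hCS hC hne
    have := hne.to_subtype
    refine ⟨⋂₀ C, ⟨isClosed_sInter fun s hs => (hCS hs).1, ?_, fun a x hx s hs =>
      (hCS hs).2.2 a x (hx s hs)⟩, fun s hs => Set.sInter_subset_of_mem hs⟩
    rw [Set.sInter_eq_iInter]
    exact IsCompact.nonempty_iInter_of_directed_nonempty_isCompact_isClosed _
      (directedOn_iff_directed.1 (IsChain.directedOn (r := fun s t : Set Y => s ⊇ t) hC.symm))
      (fun s => (hCS s.2).2.1)
      (fun s => (hCS s.2).1.isCompact) (fun s => (hCS s.2).1))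
    Set.univ ⟨isClosed_univ, Set.univ_nonempty, fun _ _ _ => trivial⟩
  obtain ⟨hLcl, hLne, hLmul⟩ := hL.prop
  have hmin : ∀ x ∈ L, ∀ y ∈ L, ∃ a, a * x = y := by
    intro x hx y hy
    have : Set.range (fun a => a * x) ∈ S :=
      ⟨(isCompact_range (by fun_prop)).isClosed, Set.range_nonempty _, by
        rintro a _ ⟨b, rfl⟩
        exact ⟨a * b, mul_assoc _ _ _⟩⟩
    exact hL.le_of_le this (by rintro _ ⟨a, rfl⟩; exact hLmul a x hx) hy
  obtain ⟨e, heL, he⟩ := exists_idempotent_in_compact_subsemigroup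
    (fun r : Y => by fun_prop) L hLne hLcl.isCompact (fun x _ y hy => hLmul x y hy)
  refine ⟨e, he, fun h h1 h2 => ?_⟩
  obtain ⟨y, hy⟩ := hmin h (h2 ▸ hLmul h e heL) e heL
  refine ⟨e * y * e, ?_, ?_, ?_⟩
  · rw [← mul_assoc, ← mul_assoc, he]
  · rw [mul_assoc, he]
  · rw [mul_assoc, h1, mul_assoc, hy, he]

theorem mk_subsemigroupClosure_lt {M : Type u} [Semigroup M] {κ : Cardinal.{u}} (hκ : ℵ₀ < κ)
    (s : Set M) (hs : #s < κ) : #(Subsemigroup.closure s) < κ := by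
  have hle : Subsemigroup.closure s ≤ (FreeSemigroup.lift ((↑) : s → M)).srange :=
    Subsemigroup.closure_le.2 fun x hx => ⟨FreeSemigroup.of ⟨x, hx⟩, rfl⟩
  have h1 : #(Subsemigroup.closure s) ≤ #(s × List s) := by
    refine (mk_le_mk_of_subset hle).trans (mk_range_le.trans ?_)
    refine mk_le_of_injective (f := fun w : FreeSemigroup s => (w.head, w.tail)) ?_
    rintro ⟨a, l⟩ ⟨b, m⟩ h
    simpa using h
  refine h1.trans_lt ?_
  rw [mk_prod, lift_id, lift_id]
  exact mul_lt_of_lt hκ.le hs ((mk_list_le_max s).trans_lt (max_lt hκ hs))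

/-- The semigroup of functions generated by the maps `x ↦ sxt` with `s, t ∈ S`. -/
def polySemigroup {Y : Type*} [Semigroup Y] (S : Set Y) : Subsemigroup (Y → Y) :=
  Subsemigroup.closure (Set.image2 (fun s t x => s * x * t) S S)

section polySemigroup

variable {Y : Type*} [Semigroup Y]

theorem mul_mul_mem_polySemigroup {S : Set Y} {s t : Y} (hs : s ∈ S) (ht : t ∈ S) :
    (fun x => s * x * t) ∈ polySemigroup S :=
  Subsemigroup.subset_closure ⟨s, hs, t, ht, rfl⟩

theorem polySemigroup_mono {S T : Set Y} (h : S ⊆ T) : polySemigroup S ≤ polySemigroup T :=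
  Subsemigroup.closure_mono (Set.image2_subset h h)

theorem const_mul_mem_polySemigroup {S : Subsemigroup Y} {f : Y → Y}
    (hf : f ∈ polySemigroup (S : Set Y)) {a : Y} (ha : a ∈ S) :
    (fun x => a * f x) ∈ polySemigroup (S : Set Y) := by
  induction hf using Subsemigroup.closure_induction with
  | mem f hf =>
    obtain ⟨s, hs, t, ht, rfl⟩ := hf
    simpa only [mul_assoc] using mul_mul_mem_polySemigroup (S.mul_mem ha hs) ht
  | mul f g _ hg ihf ihg =>
    have h := Subsemigroup.mul_mem _ ihf hg
    simpa only [Pi.mul_def, mul_assoc] using h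

theorem mul_const_mem_polySemigroup {S : Subsemigroup Y} {f : Y → Y}
    (hf : f ∈ polySemigroup (S : Set Y)) {a : Y} (ha : a ∈ S) :
    (fun x => f x * a) ∈ polySemigroup (S : Set Y) := by
  induction hf using Subsemigroup.closure_induction with
  | mem f hf =>
    obtain ⟨s, hs, t, ht, rfl⟩ := hf
    simpa only [mul_assoc] using mul_mul_mem_polySemigroup hs (S.mul_mem ht ha)
  | mul f g hf _ ihf ihg =>
    have h := Subsemigroup.mul_mem (polySemigroup (S : Set Y)) hf ihg
    simpa only [Pi.mul_def, mul_assoc] using h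

theorem comp_mul_mul_mem_polySemigroup {f : Y → Y} (hf : f ∈ polySemigroup Set.univ) (a b : Y) :
    (fun x => f (a * x * b)) ∈ polySemigroup (Set.univ : Set Y) := by
  induction hf using Subsemigroup.closure_induction with
  | mem f hf =>
    obtain ⟨s, -, t, -, rfl⟩ := hf
    simpa only [mul_assoc] using
      mul_mul_mem_polySemigroup (Set.mem_univ (s * a)) (Set.mem_univ (b * t))
  | mul f g _ _ ihf ihg => exact Subsemigroup.mul_mem _ ihf ihg

theorem apply_mem_of_mem_polySemigroup {S T : Subsemigroup Y} (h : S ≤ T) {f : Y → Y}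
    (hf : f ∈ polySemigroup (S : Set Y)) {x : Y} (hx : x ∈ T) : f x ∈ T := by
  induction hf using Subsemigroup.closure_induction with
  | mem f hf =>
    obtain ⟨s, hs, t, ht, rfl⟩ := hf
    exact T.mul_mem (T.mul_mem (h hs) hx) (h ht)
  | mul f g _ _ ihf ihg => exact T.mul_mem ihf ihg

theorem continuous_of_mem_polySemigroup [TopologicalSpace Y] [ContinuousMul Y] {S : Set Y}
    {f : Y → Y} (hf : f ∈ polySemigroup S) : Continuous f := by
  induction hf using Subsemigroup.closure_induction with
  | mem f hf =>
    obtain ⟨s, hs, t, ht, rfl⟩ := hf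
    fun_prop
  | mul f g _ _ ihf ihg => exact ihf.mul ihg

end polySemigroup

theorem mk_polySemigroup_lt {Y : Type u} [Semigroup Y] {κ : Cardinal.{u}} (hκ : ℵ₀ < κ)
    {S : Set Y} (hS : #S < κ) : #(polySemigroup S) < κ := by
  refine mk_subsemigroupClosure_lt hκ _ ?_
  rw [← Set.image_prod]
  refine mk_image_le.trans_lt ?_
  rw [mk_congr (Equiv.Set.prod S S), ← mul_def]
  exact mul_lt_of_lt hκ.le hS hS

theorem exists_isZeroFilter {Y : Type u} [Semigroup Y] {κ : Cardinal.{u}} (hκ : ℵ₀ < κ)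
    (hY : #Y ≤ κ)
    (hpick : ∀ S : Subsemigroup Y, #S < κ → ∃ x, ∀ f ∈ polySemigroup (S : Set Y), f x ∉ S) :
    ∃ F : Filter Y, IsZeroFilter F := by
  classical
  let ι := κ.ord.ToType
  have : NoMaxOrder ι := Cardinal.noMaxOrder hκ.le
  have hι : #ι = κ := mk_ord_toType κ
  have : Nonempty ι := mk_ne_zero_iff.1 (by rw [hι]; exact (aleph0_pos.trans hκ).ne')
  have hne : Nonempty Y := by
    obtain ⟨x, -⟩ := hpick ⊥ (by
      have : IsEmpty (⊥ : Subsemigroup Y) := ⟨fun x => Subsemigroup.notMem_bot x.2⟩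
      rw [mk_eq_zero]; exact aleph0_pos.trans hκ)
    exact ⟨x⟩
  obtain ⟨b, hb⟩ : ∃ b : ι → Y, Function.Surjective b := by
    obtain ⟨j⟩ := (hι ▸ hY : #Y ≤ #ι)
    exact ⟨_, Function.invFun_surjective j.injective⟩
  let pick : Subsemigroup Y → Y := fun S =>
    if h : #S < κ then (hpick S h).choose else Classical.arbitrary Y
  have hpick' : ∀ S : Subsemigroup Y, #S < κ → ∀ f ∈ polySemigroup (S : Set Y), f (pick S) ∉ S := by
    intro S h
    simp only [pick, dif_pos h]
    exact (hpick S h).choose_spec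
  let x : ι → Y := wellFounded_lt.fix fun β ih =>
    pick (Subsemigroup.closure (b '' Set.Iio β ∪ {y | ∃ γ, ∃ h : γ < β, ih γ h = y}))
  let S : ι → Subsemigroup Y := fun β => Subsemigroup.closure (b '' Set.Iio β ∪ x '' Set.Iio β)
  have hx : ∀ β, x β = pick (S β) := by
    intro β
    simp only [x]
    rw [WellFounded.fix_eq]
    congr 3
    ext y
    simp [x]
  have hSκ : ∀ β, #(S β) < κ := by
    intro β
    have hβ : #(Set.Iio β) < κ :=
      (mk_Iio_lt β (by rw [hι]; exact (Ordinal.type_toType _).symm)).trans_eq hι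
    exact mk_subsemigroupClosure_lt hκ _ ((mk_union_le _ _).trans_lt
      (add_lt_of_lt hκ.le (mk_image_le.trans_lt hβ) (mk_image_le.trans_lt hβ)))
  have hSmono : Monotone S := fun α β h => Subsemigroup.closure_mono
    (Set.union_subset_union (Set.image_mono (Set.Iio_subset_Iio h))
      (Set.image_mono (Set.Iio_subset_Iio h)))
  have hbS : ∀ {γ β}, γ < β → b γ ∈ S β := fun h =>
    Subsemigroup.subset_closure (Or.inl ⟨_, h, rfl⟩)
  have hxS : ∀ {γ β}, γ < β → x γ ∈ S β := fun h =>
    Subsemigroup.subset_closure (Or.inr ⟨_, h, rfl⟩)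
  have havoid : ∀ β, ∀ f ∈ polySemigroup (S β : Set Y), f (x β) ∉ S β := by
    intro β
    rw [hx]
    exact hpick' _ (hSκ β)
  let V : ι → Set Y := fun α => {y | ∃ β, α ≤ β ∧ ∃ f ∈ polySemigroup (S β : Set Y), f (x β) = y}
  have hV : (⨅ α, 𝓟 (V α)).HasBasis (fun _ => True) V :=
    hasBasis_iInf_principal (directed_of_isDirected_le fun α α' h y ⟨β, hβ, hy⟩ =>
      ⟨β, h.trans hβ, hy⟩)
  refine ⟨⨅ α, 𝓟 (V α), ?_, ?_, ?_, ?_, ?_⟩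
  · refine hV.neBot_iff.2 fun {α} _ => ?_
    obtain ⟨β, hβ⟩ := exists_gt α
    exact ⟨_, β, hβ.le, _, mul_mul_mem_polySemigroup (hbS hβ) (hbS hβ), rfl⟩
  · intro y
    obtain ⟨γ, rfl⟩ := hb y
    obtain ⟨α, hα⟩ := exists_gt γ
    refine hV.mem_iff.2 ⟨α, trivial, ?_⟩
    rintro _ ⟨β, hβ, f, hf, rfl⟩ h
    exact havoid β f hf ((Set.mem_singleton_iff.1 h) ▸ hbS (hα.trans_le hβ))
  · intro y
    obtain ⟨γ, rfl⟩ := hb y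
    refine (hV.tendsto_iff hV).2 fun α _ => ?_
    obtain ⟨δ, hδ⟩ := exists_gt (max α γ)
    refine ⟨δ, trivial, ?_⟩
    rintro _ ⟨β, hβ, f, hf, rfl⟩
    have h := hδ.trans_le hβ
    exact ⟨β, ((le_max_left _ _).trans_lt h).le, _,
      const_mul_mem_polySemigroup hf (hbS ((le_max_right _ _).trans_lt h)), rfl⟩
  · intro y
    obtain ⟨γ, rfl⟩ := hb y
    refine (hV.tendsto_iff hV).2 fun α _ => ?_
    obtain ⟨δ, hδ⟩ := exists_gt (max α γ)
    refine ⟨δ, trivial, ?_⟩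
    rintro _ ⟨β, hβ, f, hf, rfl⟩
    have h := hδ.trans_le hβ
    exact ⟨β, ((le_max_left _ _).trans_lt h).le, _,
      mul_const_mem_polySemigroup hf (hbS ((le_max_right _ _).trans_lt h)), rfl⟩
  · refine ((hV.prod_self).tendsto_iff hV).2 fun α _ => ⟨α, trivial, ?_⟩
    rintro ⟨_, _⟩ ⟨⟨β, hβ, f, hf, rfl⟩, ⟨γ, hγ, g, hg, rfl⟩⟩
    rcases lt_trichotomy β γ with h | rfl | h
    · exact ⟨γ, hγ, _, const_mul_mem_polySemigroup hg
        (apply_mem_of_mem_polySemigroup (hSmono h.le) hf (hxS h)), rfl⟩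
    · exact ⟨β, hβ, _, Subsemigroup.mul_mem _ hf hg, rfl⟩
    · exact ⟨β, hβ, _, mul_const_mem_polySemigroup hf
        (apply_mem_of_mem_polySemigroup (hSmono h.le) hg (hxS h)), rfl⟩

/-- A compact Hausdorff second-countable semigroup which has no zero filters and has cardinality at
most `cov(M)` is covered by finitely many sets `{x | f x = b}`. -/
theorem exists_finite_polySemigroup_cover {Y : Type u} [Semigroup Y] [TopologicalSpace Y]
    [CompactSpace Y] [T2Space Y] [SecondCountableTopology Y] [ContinuousMul Y]
    [Nonempty Y] (hκ : ℵ₀ < covMeager) (hY : #Y ≤ Cardinal.lift.{u} covMeager)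
    (hF : ∀ F : Filter Y, ¬ IsZeroFilter F) :
    ∃ t : Finset (Y → Y), (∀ f ∈ t, f ∈ polySemigroup Set.univ) ∧ ∃ b, ∀ x, ∃ f ∈ t, f x = b := by
  have hκ' : ℵ₀ < Cardinal.lift.{u} covMeager := by simpa using hκ
  obtain ⟨e, he, hinv⟩ := exists_idempotent_forall_exists_mul_eq (Y := Y)
  let H : Set Y := {h | e * h = h ∧ h * e = h}
  have hHcl : IsClosed H := by
    exact (isClosed_eq (by fun_prop) (by fun_prop)).inter (isClosed_eq (by fun_prop) (by fun_prop))
  have : CompactSpace H := isCompact_iff_compactSpace.1 hHcl.isCompact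
  have : Nonempty H := ⟨⟨e, he, he⟩⟩
  by_cases hint : ∀ f ∈ polySemigroup (Set.univ : Set Y), ∀ b : Y,
      interior {h : H | f h = b} = ∅
  · refine absurd (exists_isZeroFilter hκ' hY fun S hS => ?_) (not_exists.2 hF)
    obtain ⟨z, hz⟩ := exists_notMem_of_mk_lt_covMeager
      (fun i : polySemigroup (S : Set Y) × S => {h : H | i.1.1 h = i.2})
      (fun i => isClosed_eq ((continuous_of_mem_polySemigroup i.1.2).comp continuous_subtype_val)
        continuous_const)
      (fun i => hint _ (polySemigroup_mono (Set.subset_univ _) i.1.2) _)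
      (by
        rw [mk_prod, lift_id, lift_id]
        exact mul_lt_of_lt hκ'.le (mk_polySemigroup_lt hκ' hS) hS)
    exact ⟨z, fun f hf hfS => hz ⟨⟨f, hf⟩, ⟨_, hfS⟩⟩ rfl⟩
  push Not at hint
  obtain ⟨f, hf, b, ⟨o, ho⟩⟩ := hint
  obtain ⟨O, hOsub, hOo, hoO⟩ := mem_interior.1 ho
  have hmulmem : ∀ {g h}, g ∈ H → h ∈ H → g * h ∈ H := fun hg hh =>
    ⟨by rw [← mul_assoc, hg.1], by rw [mul_assoc, hh.2]⟩
  let m : H → H → H := fun g h => ⟨g.1 * h.1, hmulmem g.2 h.2⟩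
  have hm : ∀ g, Continuous (m g) := fun g => by
    unfold m
    fun_prop
  obtain ⟨t, ht⟩ := isCompact_univ.elim_finite_subcover (fun g : H => m g ⁻¹' O)
    (fun g => hOo.preimage (hm g)) (by
      intro h _
      obtain ⟨g, hg1, hg2, hgh⟩ := hinv h h.2.1 h.2.2
      refine Set.mem_iUnion.2 ⟨m o ⟨g, hg1, hg2⟩, ?_⟩
      have : m (m o ⟨g, hg1, hg2⟩) h = o := Subtype.ext (by
        simp only [m]
        rw [mul_assoc, hgh, o.2.2])
      rwa [Set.mem_preimage, this])
  classical
  refine ⟨t.image fun (g : H) x => f (g * x * e), ?_, b, fun x => ?_⟩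
  · intro f' hf'
    obtain ⟨g, -, rfl⟩ := Finset.mem_image.1 hf'
    exact comp_mul_mul_mem_polySemigroup hf _ _
  · have hxH : e * x * e ∈ H := ⟨by rw [← mul_assoc, ← mul_assoc, he], by rw [mul_assoc, he]⟩
    obtain ⟨g, hg, hgx⟩ := Set.mem_iUnion₂.1 (ht (Set.mem_univ ⟨_, hxH⟩))
    refine ⟨_, Finset.mem_image_of_mem _ hg, ?_⟩
    have h := hOsub hgx
    simpa only [m, Set.mem_ofPred_eq, ← mul_assoc, g.2.2] using h

/-- The product of `sᵢxtᵢ` over `i ≤ n`, where `p i = (sᵢ, tᵢ)`. -/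
def polyProd {X : Type*} [Semigroup X] : ℕ → (ℕ → X × X) → X → X
  | 0, p, x => (p 0).1 * x * (p 0).2
  | n + 1, p, x => (p 0).1 * x * (p 0).2 * polyProd n (fun i => p (i + 1)) x

theorem continuous_polyProd {X : Type*} [Semigroup X] [TopologicalSpace X] [ContinuousMul X]
    (n : ℕ) (x : X) : Continuous fun p : ℕ → X × X => polyProd n p x := by
  induction n with
  | zero => unfold polyProd; fun_prop
  | succ n ih =>
    have : Continuous fun p : ℕ → X × X => polyProd n (fun i => p (i + 1)) x :=
      ih.comp (by fun_prop)
    unfold polyProd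
    fun_prop

theorem map_polyProd {X Y : Type*} [Semigroup X] [Semigroup Y] (φ : X →ₙ* Y) (n : ℕ)
    (p : ℕ → X × X) (x : X) :
    φ (polyProd n p x) = polyProd n (fun i => (φ (p i).1, φ (p i).2)) (φ x) := by
  induction n generalizing p with
  | zero => simp [polyProd]
  | succ n ih => simp [polyProd, ih]

theorem exists_polyVal_eq_polyProd {X : Type*} [Semigroup X] (n : ℕ) (p : ℕ → X × X) :
    ∃ a : List (WithOne X), 2 ≤ a.length ∧ ∀ x, polyVal a x = (polyProd n p x : X) := by
  induction n generalizing p with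
  | zero => exact ⟨[(p 0).1, (p 0).2], by simp, fun x => by simp [polyVal, polyProd, mul_assoc]⟩
  | succ n ih =>
    obtain ⟨_ | ⟨a, l⟩, hl, h⟩ := ih fun i => p (i + 1)
    · simp at hl
    · refine ⟨(p 0).1 :: ((p 0).2 * a) :: l, by simp, fun x => ?_⟩
      have h := h x
      simp only [polyVal] at h
      simp only [polyVal, polyProd, WithOne.coe_mul, ← h, List.map_cons, List.prod_cons, mul_assoc]

theorem exists_polyProd_mul_eq {Y : Type*} [Semigroup Y] (n m : ℕ) (p q : ℕ → Y × Y) :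
    ∃ k r, polyProd n p * polyProd m q = polyProd (X := Y) k r := by
  induction n generalizing p with
  | zero => exact ⟨m + 1, fun i => Nat.casesOn i (p 0) q, rfl⟩
  | succ n ih =>
    obtain ⟨k, r, hr⟩ := ih fun i => p (i + 1)
    refine ⟨k + 1, fun i => Nat.casesOn i (p 0) r, ?_⟩
    funext x
    simp [polyProd, ← hr, mul_assoc]

theorem exists_polyProd_of_mem_polySemigroup {Y : Type*} [Semigroup Y] {S : Set Y} {f : Y → Y}
    (hf : f ∈ polySemigroup S) : ∃ n p, f = polyProd n p := by
  induction hf using Subsemigroup.closure_induction with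
  | mem f hf =>
    obtain ⟨s, -, t, -, rfl⟩ := hf
    exact ⟨0, fun _ => (s, t), rfl⟩
  | mul f g _ _ ihf ihg =>
    obtain ⟨n, p, rfl⟩ := ihf
    obtain ⟨m, q, rfl⟩ := ihg
    exact exists_polyProd_mul_eq n m p q

/-- The coefficients `q` define polynomials of degree at most `N` whose sets of solutions modulo
the relation `r` cover `X`. -/
def PolyCovers {X : Type*} [Semigroup X] (r : X → X → Prop) (N : ℕ)
    (q : (ℕ → ℕ → X × X) × (ℕ → X)) : Prop :=
  ∀ x, ∃ i < N, ∃ n < N, r (polyProd n (q.1 i) x) (q.2 i)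

theorem PolyCovers.polybounded {X : Type*} [Semigroup X] {N : ℕ}
    {q : (ℕ → ℕ → X × X) × (ℕ → X)} (h : PolyCovers (· = ·) N q) : Polybounded X := by
  refine ⟨(fun k : ℕ × ℕ => {x | polyProd k.2 (q.1 k.1) x = q.2 k.1}) '' (Set.Iio N ×ˢ Set.Iio N),
    ((Set.finite_Iio N).prod (Set.finite_Iio N)).image _, ?_, fun x _ => ?_⟩
  · rintro _ ⟨⟨i, n⟩, -, rfl⟩
    obtain ⟨a, ha, hax⟩ := exists_polyVal_eq_polyProd n (q.1 i)
    exact ⟨a, q.2 i, ha, by simp [hax]⟩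
  · obtain ⟨i, hi, n, hn, hx⟩ := h x
    exact ⟨_, ⟨(i, n), ⟨hi, hn⟩, rfl⟩, hx⟩

theorem exists_polyCovers_of_finset {Y : Type*} [Semigroup Y] {t : Finset (Y → Y)}
    (ht : ∀ f ∈ t, f ∈ polySemigroup Set.univ) {b : Y} (h : ∀ x, ∃ f ∈ t, f x = b) :
    ∃ N q, PolyCovers (X := Y) (· = ·) N q := by
  obtain ⟨g, hg⟩ := t.countable_toSet.exists_eq_range (by
    obtain ⟨f, hf, -⟩ := h b
    exact ⟨f, hf⟩)
  have hgt : ∀ i, g i ∈ t := fun i => by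
    rw [← Finset.mem_coe, hg]
    exact ⟨i, rfl⟩
  choose d p hdp using fun i => exists_polyProd_of_mem_polySemigroup (ht _ (hgt i))
  have hk : ∀ f : Y → Y, ∃ i, f ∈ t → g i = f := by
    intro f
    by_cases hf : f ∈ t
    · rw [← Finset.mem_coe, hg] at hf
      exact hf.imp fun i hi _ => hi
    · exact ⟨0, fun h => absurd h hf⟩
  choose k hk using hk
  refine ⟨t.sup (fun f => max (k f) (d (k f))) + 1, (p, fun _ => b), fun x => ?_⟩
  obtain ⟨f, hf, hfx⟩ := h x
  have hle := Finset.le_sup (f := fun f => max (k f) (d (k f))) hf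
  refine ⟨k f, Nat.lt_succ_of_le ((le_max_left _ _).trans hle), d (k f),
    Nat.lt_succ_of_le ((le_max_right _ _).trans hle), ?_⟩
  rw [← hdp, hk f hf, hfx]

/-- The congruence `r` is the kernel of a continuous map to `ℕ → ℝ`. -/
def IsCountablySeparated {X : Type*} [Semigroup X] [TopologicalSpace X] (r : Con X) : Prop :=
  ∃ g : X → ℕ → ℝ, Continuous g ∧ ∀ x y, r x y ↔ g x = g y

section IsCountablySeparated

variable {X : Type*} [Semigroup X] [TopologicalSpace X]

theorem IsCountablySeparated.iInf {r : ℕ → Con X} (h : ∀ n, IsCountablySeparated (r n)) :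
    IsCountablySeparated (⨅ n, r n) := by
  choose g hg hgr using h
  refine ⟨fun x k => g k.unpair.1 x k.unpair.2,
    continuous_pi fun k => (continuous_apply _).comp (hg _), fun x y => ?_⟩
  have h1 : (⨅ n, r n) x y ↔ ∀ n, r n x y := by
    simp [Con.coe_iInf]
  simp only [h1, hgr, funext_iff]
  exact ⟨fun h k => h _ _, fun h n m => by simpa using h (Nat.pair n m)⟩

theorem exists_isCountablySeparated [CompactSpace X] [T2Space X] [ContinuousMul X] {x y : X}
    (hxy : x ≠ y) : ∃ r : Con X, IsCountablySeparated r ∧ ¬ r x y := by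
  obtain ⟨f, hf⟩ : ∃ f : C(X, ℝ), f x ≠ f y := by
    obtain ⟨f, hf0, hf1, -⟩ := exists_continuous_zero_one_of_isClosed
      (isClosed_singleton (x := x)) (isClosed_singleton (x := y)) (by simpa using hxy)
    exact ⟨f, by rw [hf0 rfl, hf1 rfl]; simp⟩
  let Φ : X → ℝ × C(X, ℝ) × C(X, ℝ) × C(X × X, ℝ) := fun z =>
    (f z, ⟨fun a => f (a * z), by fun_prop⟩, ⟨fun b => f (z * b), by fun_prop⟩,
      ⟨fun c => f (c.1 * z * c.2), by fun_prop⟩)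
  have hΦ : Continuous Φ := by
    refine f.continuous.prodMk (Continuous.prodMk ?_ (Continuous.prodMk ?_ ?_))
    · exact ContinuousMap.continuous_of_continuous_uncurry _ (by
        simp only [Function.uncurry_def, ContinuousMap.coe_mk]; fun_prop)
    · exact ContinuousMap.continuous_of_continuous_uncurry _ (by
        simp only [Function.uncurry_def, ContinuousMap.coe_mk]; fun_prop)
    · exact ContinuousMap.continuous_of_continuous_uncurry _ (by
        simp only [Function.uncurry_def, ContinuousMap.coe_mk]; fun_prop)
  have hΦ_iff : ∀ z w, Φ z = Φ w ↔ f z = f w ∧ (∀ a, f (a * z) = f (a * w)) ∧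
      (∀ b, f (z * b) = f (w * b)) ∧ ∀ a b, f (a * z * b) = f (a * w * b) := by
    intro z w
    simp [Φ, ContinuousMap.ext_iff]
  let r : Con X :=
    { r := fun z w => Φ z = Φ w
      iseqv := ⟨fun _ => rfl, Eq.symm, Eq.trans⟩
      mul' := by
        intro a b c d hab hcd
        have h1 : Φ (a * c) = Φ (b * c) := by
          rw [hΦ_iff] at hab ⊢
          obtain ⟨h1, h2, h3, h4⟩ := hab
          refine ⟨h3 c, fun u => ?_, fun u => ?_, fun u v => ?_⟩
          · simpa only [mul_assoc] using h4 u c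
          · simpa only [mul_assoc] using h3 (c * u)
          · simpa only [mul_assoc] using h4 u (c * v)
        have h2 : Φ (b * c) = Φ (b * d) := by
          rw [hΦ_iff] at hcd ⊢
          obtain ⟨h1, h2, h3, h4⟩ := hcd
          refine ⟨h2 b, fun u => ?_, fun u => ?_, fun u v => ?_⟩
          · simpa only [mul_assoc] using h2 (u * b)
          · simpa only [mul_assoc] using h4 b u
          · simpa only [mul_assoc] using h4 (u * b) v
        exact h1.trans h2 }
  refine ⟨r, ?_, fun h => hf ((hΦ_iff x y).1 h).1⟩
  obtain ⟨c, hc, hΦc⟩ := (isCompact_range hΦ).isSeparable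
  obtain ⟨u, rfl⟩ := hc.exists_eq_range (by
    by_contra hemp
    rw [Set.not_nonempty_iff_eq_empty] at hemp
    have := hΦc ⟨x, rfl⟩
    simp [hemp] at this)
  refine ⟨fun z n => dist (Φ z) (u n), by fun_prop, fun z w => ⟨fun h => ?_, fun h => ?_⟩⟩
  · have h : Φ z = Φ w := h
    simp only [h]
  · refine eq_of_dist_eq_zero (le_antisymm (le_of_forall_pos_le_add fun ε hε => ?_) dist_nonneg)
    obtain ⟨_, ⟨n, rfl⟩, hn⟩ := Metric.mem_closure_iff.1 (hΦc ⟨z, rfl⟩) (ε / 2) (by positivity)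
    have h1 : dist (Φ z) (u n) = dist (Φ w) (u n) := congrFun h n
    have := dist_triangle_right (Φ z) (Φ w) (u n)
    linarith

theorem exists_polyCovers_eq [CompactSpace X] [T2Space X] [ContinuousMul X] [Nonempty X]
    (h : ∀ r : Con X, IsCountablySeparated r → ∃ N q, PolyCovers r N q) :
    ∃ N q, PolyCovers (X := X) (· = ·) N q := by
  have hmono : ∀ {r s : Con X} {N q}, r ≤ s → PolyCovers r N q → PolyCovers s N q := by
    intro r s N q hrs hq x
    obtain ⟨i, hi, n, hn, h⟩ := hq x
    exact ⟨i, hi, n, hn, hrs h⟩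
  obtain ⟨N, hN⟩ : ∃ N, ∀ r : Con X, IsCountablySeparated r → ∃ q, PolyCovers r N q := by
    by_contra! hcon
    choose r hr hrN using hcon
    obtain ⟨N, q, hq⟩ := h _ (IsCountablySeparated.iInf hr)
    exact hrN N q (hmono (iInf_le r N) hq)
  let R := {r : Con X // IsCountablySeparated r}
  have hinf : ∀ r : ℕ → R, ∃ s : R, ∀ n, s.1 ≤ (r n).1 := fun r =>
    ⟨⟨_, IsCountablySeparated.iInf fun n => (r n).2⟩, iInf_le _⟩
  have hclosed : ∀ r : R, IsClosed {q | PolyCovers r.1 N q} := by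
    rintro ⟨r, g, hg, hgr⟩
    have : {q | PolyCovers r N q} = ⋂ x, ⋃ i ∈ Set.Iio N, ⋃ n ∈ Set.Iio N,
        {q : (ℕ → ℕ → X × X) × (ℕ → X) | g (polyProd n (q.1 i) x) = g (q.2 i)} := by
      ext q
      simp [PolyCovers, hgr]
    rw [this]
    refine isClosed_iInter fun x => (Set.finite_Iio N).isClosed_biUnion fun i _ =>
      (Set.finite_Iio N).isClosed_biUnion fun n _ => isClosed_eq
        (hg.comp ((continuous_polyProd n x).comp (by fun_prop))) (hg.comp (by fun_prop))
  have : Nonempty R :=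
    ⟨⟨⊤, fun _ _ => 0, continuous_const, fun x y => ⟨fun _ => rfl, fun _ => trivial⟩⟩⟩
  obtain ⟨q, hq⟩ := IsCompact.nonempty_iInter_of_directed_nonempty_isCompact_isClosed
    (fun r : R => {q | PolyCovers r.1 N q}) (fun r s => by
      obtain ⟨t, ht⟩ := hinf fun n => if n = 0 then r else s
      exact ⟨t, fun q hq => hmono (by simpa using ht 0) hq,
        fun q hq => hmono (by simpa using ht 1) hq⟩)
    (fun r => hN r.1 r.2) (fun r => (hclosed r).isCompact) hclosed
  refine ⟨N, q, fun x => ?_⟩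
  by_contra! hcon
  have hsep : ∀ k : ℕ × ℕ, ∃ r : R, k.1 < N → k.2 < N →
      ¬ r.1 (polyProd k.2 (q.1 k.1) x) (q.2 k.1) := by
    rintro ⟨i, n⟩
    by_cases hk : i < N ∧ n < N
    · obtain ⟨r, hr, hrx⟩ := exists_isCountablySeparated (hcon i hk.1 n hk.2)
      exact ⟨⟨r, hr⟩, fun _ _ => hrx⟩
    · exact ⟨Classical.arbitrary R, fun h1 h2 => absurd ⟨h1, h2⟩ hk⟩
  choose r hr using hsep
  obtain ⟨s, hs⟩ := hinf fun k => r k.unpair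
  obtain ⟨i, hi, n, hn, h⟩ := Set.mem_iInter.1 hq s x
  exact hr (i, n) hi hn (by simpa using hs (Nat.pair i n) h)

end IsCountablySeparated

theorem exists_polyCovers_con {X : Type u} [Semigroup X] [TopologicalSpace X] [CompactSpace X]
    [ContinuousMul X] [Nonempty X] (hz : ZeroClosed X) (hcov : covMeager = 𝔠)
    {r : Con X} (hr : IsCountablySeparated r) : ∃ N q, PolyCovers r N q := by
  obtain ⟨g, hg, hgr⟩ := hr
  let π : X →ₙ* r.Quotient := ⟨(↑), fun _ _ => rfl⟩
  have hπ : Function.Surjective π := Quotient.mk_surjective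
  let τ : TopologicalSpace r.Quotient := .coinduced π inferInstance
  have hq : IsQuotientMap π := ⟨⟨rfl⟩, hπ⟩
  have : CompactSpace r.Quotient := hq.surjective.compactSpace hq.continuous
  obtain ⟨γ, hγ⟩ : ∃ γ : r.Quotient → ℕ → ℝ, ∀ x, γ (π x) = g x :=
    ⟨Quotient.lift g fun x y h => (hgr x y).1 h, fun _ => rfl⟩
  have hγc : Continuous γ := by
    rw [hq.continuous_iff]
    simpa only [Function.comp_def, hγ] using hg
  have hγi : Function.Injective γ := by
    intro a b hab
    obtain ⟨x, rfl⟩ := hπ a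
    obtain ⟨y, rfl⟩ := hπ b
    rw [hγ, hγ, ← hgr] at hab
    exact (Con.eq r).2 hab
  have : T2Space r.Quotient := T2Space.of_injective_continuous hγi hγc
  have : SecondCountableTopology r.Quotient :=
    (hγc.isClosedEmbedding hγi).isEmbedding.secondCountableTopology
  have : ContinuousMul r.Quotient := by
    have hq2 : IsQuotientMap (Prod.map π π) :=
      (hq.continuous.prodMap hq.continuous).isClosedMap.isQuotientMap
        (hq.continuous.prodMap hq.continuous) (hπ.prodMap hπ)
    refine ⟨hq2.continuous_iff.2 ?_⟩
    have h : Continuous fun p : X × X => π (p.1 * p.2) := hq.continuous.comp (by fun_prop)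
    simpa only [map_mul, Function.comp_def, Prod.map] using h
  have hcard : #r.Quotient ≤ Cardinal.lift.{u} covMeager := by
    have := lift_mk_le_lift_mk_of_injective hγi
    simpa [hcov, mk_real] using this
  have : Nonempty r.Quotient := Nonempty.map π inferInstance
  obtain ⟨t, ht, b, hb⟩ := exists_finite_polySemigroup_cover
    (by rw [hcov]; exact aleph0_lt_continuum)
    hcard fun F hF => hz.not_isZeroFilter _ (hF.comap π hπ)
  obtain ⟨N, ⟨p, b⟩, hN⟩ := exists_polyCovers_of_finset ht hb
  choose σ hσ using hπ
  refine ⟨N, (fun i n => (σ (p i n).1, σ (p i n).2), fun i => σ (b i)), fun x => ?_⟩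
  obtain ⟨i, hi, n, hn, h⟩ := hN (π x)
  refine ⟨i, hi, n, hn, (Con.eq r).1 ?_⟩
  change π _ = π _
  simpa only [map_polyProd, hσ] using h

/-- Under `cov(M) = 𝔠`, every zero-closed semigroup admitting a compact
Hausdorff semigroup topology is polybounded. -/
theorem statement4 {X : Type u} [Semigroup X] (hz : ZeroClosed X)
    (htop : ∃ τ : TopologicalSpace X,
      @CompactSpace X τ ∧ @T2Space X τ ∧ @ContinuousMul X τ _)
    (hcov : covMeager = Cardinal.continuum) :
    Polybounded X := by
  rcases isEmpty_or_nonempty X with hX | hX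
  · exact ⟨∅, Set.finite_empty, by simp, fun x => hX.elim x⟩
  obtain ⟨τ, _, _, _⟩ := htop
  obtain ⟨N, q, hq⟩ := exists_polyCovers_eq fun r hr => exists_polyCovers_con hz hcov hr
  exact hq.polybounded

end ZeroClosedPaper
end
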